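/- arXiv:1904.04343 — 5 statements merged into one kernel-verified Lean document; each statement's English description precedes it below -/
import Mathlib

section
/- Let R be a Lie conformal algebra and let φ be a conformal biderivation of R, i.e., a conformal bilinear map φ_λ : R × R → R[λ] satisfying skew-symmetry φ_λ(x,y) = -φ_{-∂-λ}(y,x) and the derivation property φ_λ(x,[y_μ z]) = [(φ_λ(x,y))_{λ+μ} z] + [y_μ φ_λ(x,z)]. Then for all x, y, z ∈ R, φ_{λ+μ}([x_μ y], z) = [x_μ φ_λ(y,z)] - [y_λ φ_μ(x,z)]. -/
/- Framework: a Lie conformal algebra over ℂ is a ℂ[∂]-module `R` (given by a ℂ-module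
with a ℂ-linear operator `D` for the action of `∂`) with a λ-bracket `B : R → R → R[λ]`.
We model `R[λ]` as `ℕ →₀ R` (coefficient of `λ^n` at index `n`) and `R[λ,μ,γ]` as an
iterated Finsupp.  Substitutions of the bracket variable are implemented by evaluating
the polynomial at a commuting operator (e.g. multiplication by `λ`, by `λ+μ`, or by
`-∂-λ`), and brackets/biderivations are extended to polynomial-valued arguments by
ℂ[λ,μ,γ]-bilinearity. -/

namespace ConfBider

variable {R : Type} [AddCommGroup R] [Module ℂ R]

/-- `R[λ]`. -/
abbrev Pol1 (R : Type) [AddCommGroup R] : Type := ℕ →₀ R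

/-- `R[λ,μ,γ]`: index `a` is the exponent of `λ`, then `μ`, then `γ`. -/
abbrev Pol3 (R : Type) [AddCommGroup R] : Type := ℕ →₀ (ℕ →₀ (ℕ →₀ R))

/-- Multiplication by the variable on `R[λ]`. -/
noncomputable def shift1 : Pol1 R → Pol1 R := Finsupp.mapDomain (· + 1)

/-- The action of `∂` on coefficients of `R[λ]`. -/
noncomputable def D1 (D : R →ₗ[ℂ] R) : Pol1 R → Pol1 R := Finsupp.mapRange D (map_zero D)

/-- The operator "multiplication by `-∂-λ`" on `R[λ]`. -/
noncomputable def subNeg (D : R →ₗ[ℂ] R) : Pol1 R → Pol1 R := fun z => -(D1 D z) - shift1 z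

/-- Evaluation of `f ∈ R[ν]` at the operator `e` (substitution `ν ↦ e`), inside `R[λ]`. -/
noncomputable def ev1 (f : Pol1 R) (e : Pol1 R → Pol1 R) : Pol1 R :=
  f.sum fun n r => e^[n] (Finsupp.single 0 r)

/-- Constants `R → R[λ,μ,γ]`. -/
noncomputable def iota3 : R → Pol3 R := fun r => Finsupp.single 0 (Finsupp.single 0 (Finsupp.single 0 r))

/-- Multiplication by `λ` on `R[λ,μ,γ]`. -/
noncomputable def Xl : Pol3 R → Pol3 R := Finsupp.mapDomain (· + 1)

/-- Multiplication by `μ` on `R[λ,μ,γ]`. -/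
noncomputable def Xm : Pol3 R → Pol3 R :=
  Finsupp.mapRange (Finsupp.mapDomain (· + 1)) Finsupp.mapDomain_zero

/-- Multiplication by `γ` on `R[λ,μ,γ]`. -/
noncomputable def Xg : Pol3 R → Pol3 R :=
  Finsupp.mapRange (Finsupp.mapRange (Finsupp.mapDomain (· + 1)) Finsupp.mapDomain_zero)
    Finsupp.mapRange_zero

/-- Multiplication by `λ+μ` on `R[λ,μ,γ]`. -/
noncomputable def eLM : Pol3 R → Pol3 R := fun z => Xl z + Xm z

/-- Multiplication by `μ+γ` on `R[λ,μ,γ]`. -/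
noncomputable def eMG : Pol3 R → Pol3 R := fun z => Xm z + Xg z

/-- Evaluation of `f ∈ R[ν]` at the operator `e` (substitution `ν ↦ e`), in `R[λ,μ,γ]`. -/
noncomputable def ev (f : Pol1 R) (e : Pol3 R → Pol3 R) : Pol3 R := f.sum fun n r => e^[n] (iota3 r)

/-- Extension of an `R`-argument operation `F` to a polynomial argument in `R[λ,μ,γ]`,
by ℂ[λ,μ,γ]-linearity. -/
noncomputable def lift3 (F : R → Pol3 R) : Pol3 R → Pol3 R := fun w =>
  w.sum fun a fa => fa.sum fun b fb => fb.sum fun c r => Xl^[a] (Xm^[b] (Xg^[c] (F r)))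

/-- `φ : R × R → R[λ]` is a conformal bilinear map: ℂ-bilinear with
`φ_λ(∂x,y) = -λ φ_λ(x,y)` and `φ_λ(x,∂y) = (∂+λ) φ_λ(x,y)`. -/
structure IsConfBilinear (D : R →ₗ[ℂ] R) (φ : R → R → Pol1 R) : Prop where
  add_left : ∀ x x' y, φ (x + x') y = φ x y + φ x' y
  add_right : ∀ x y y', φ x (y + y') = φ x y + φ x y'
  smul_left : ∀ (c : ℂ) x y, φ (c • x) y = c • φ x y
  smul_right : ∀ (c : ℂ) x y, φ x (c • y) = c • φ x y
  d_left : ∀ x y, φ (D x) y = -(shift1 (φ x y))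
  d_right : ∀ x y, φ x (D y) = D1 D (φ x y) + shift1 (φ x y)

/-- Skew-symmetry `φ_λ(x,y) = -φ_{-∂-λ}(y,x)`. -/
noncomputable def IsSkew (D : R →ₗ[ℂ] R) (φ : R → R → Pol1 R) : Prop :=
  ∀ x y, φ x y = -(ev1 (φ y x) (subNeg D))

/-- A Lie conformal algebra structure: conformal sesquilinearity, skew-symmetry and
the Jacobi identity `[x_λ[y_μ z]] = [[x_λ y]_{λ+μ} z] + [y_μ[x_λ z]]`. -/
structure IsLieConformal (D : R →ₗ[ℂ] R) (B : R → R → Pol1 R) : Prop where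
  bilin : IsConfBilinear D B
  skew : IsSkew D B
  jacobi : ∀ x y z,
    lift3 (fun r => ev (B x r) Xl) (ev (B y z) Xm)
      = lift3 (fun r => ev (B r z) eLM) (ev (B x y) Xl)
        + lift3 (fun r => ev (B y r) Xm) (ev (B x z) Xl)

/-- A conformal biderivation of a Lie conformal algebra `(R, D, B)`: a skew-symmetric
conformal bilinear map `φ` with `φ_λ(x,[y_μ z]) = [(φ_λ(x,y))_{λ+μ} z] + [y_μ φ_λ(x,z)]`. -/
structure IsConfBiderivation (D : R →ₗ[ℂ] R) (B : R → R → Pol1 R)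
    (φ : R → R → Pol1 R) : Prop where
  bilin : IsConfBilinear D φ
  skew : IsSkew D φ
  leibniz : ∀ x y z,
    lift3 (fun r => ev (φ x r) Xl) (ev (B y z) Xm)
      = lift3 (fun r => ev (B r z) eLM) (ev (φ x y) Xl)
        + lift3 (fun r => ev (B y r) Xm) (ev (φ x z) Xl)


set_option maxSynthPendingDepth 4

/-- Multiplication by `λ` as an linear endomorphism. -/
noncomputable def homL : Module.End ℂ (Pol3 R) := Finsupp.lmapDomain _ ℂ (· + 1)

/-- Multiplication by `μ` as an linear endomorphism. -/
noncomputable def homM : Module.End ℂ (Pol3 R) :=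
  Finsupp.mapRange.linearMap (Finsupp.lmapDomain _ ℂ (· + 1))

/-- Multiplication by `γ` as an linear endomorphism. -/
noncomputable def homG : Module.End ℂ (Pol3 R) :=
  Finsupp.mapRange.linearMap
    (Finsupp.mapRange.linearMap (Finsupp.lmapDomain _ ℂ (· + 1)))

/-- The action of `∂` on the coefficients of `R[λ,μ,γ]`. -/
noncomputable def homD (D : R →ₗ[ℂ] R) : Module.End ℂ (Pol3 R) :=
  Finsupp.mapRange.linearMap
    (Finsupp.mapRange.linearMap (Finsupp.mapRange.linearMap D))

/-- The inclusion of constants as an linear map. -/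
noncomputable def homIota : R →ₗ[ℂ] Pol3 R :=
  (Finsupp.lsingle 0).comp ((Finsupp.lsingle 0).comp (Finsupp.lsingle 0))

lemma commute_homL_homM : Commute (homL : Module.End ℂ (Pol3 R)) homM := by
  refine Finsupp.lhom_ext fun a x => ?_
  simp [homL, homM, Module.End.mul_apply, Finsupp.mapDomain_single]

lemma commute_homD_homL (D : R →ₗ[ℂ] R) : Commute (homD D) homL := by
  refine Finsupp.lhom_ext fun a x => ?_
  simp [homL, homD, Module.End.mul_apply, Finsupp.mapDomain_single]

lemma commute_homD_homM (D : R →ₗ[ℂ] R) : Commute (homD D) homM := by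
  refine Finsupp.lhom_ext fun a x => ?_
  induction x using Finsupp.induction_linear with
  | zero => simp
  | add f g hf hg => simp only [Finsupp.single_add, map_add, hf, hg]
  | single b y => simp [homM, homD, Module.End.mul_apply, Finsupp.mapDomain_single]

lemma homD_homIota (D : R →ₗ[ℂ] R) (r : R) : homD D (homIota r) = homIota (D r) := by
  simp [homD, homIota]

section Eval

variable {P : Type} [AddCommGroup P] [Module ℂ P]

/-- The linear map `∑ rₙ νⁿ ↦ ∑ Aⁿ (F rₙ)`. -/
noncomputable def evalHom (F : R →ₗ[ℂ] P) (A : Module.End ℂ P) : Pol1 R →ₗ[ℂ] P :=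
  Finsupp.lsum ℂ fun n => (A ^ n) ∘ₗ F

lemma evalHom_single (F : R →ₗ[ℂ] P) (A : Module.End ℂ P) (n : ℕ) (r : R) :
    evalHom F A (Finsupp.single n r) = (A ^ n) (F r) := by
  simp [evalHom]

lemma evalHom_shift1 (F : R →ₗ[ℂ] P) (A : Module.End ℂ P) (f : Pol1 R) :
    evalHom F A (shift1 f) = A (evalHom F A f) := by
  induction f using Finsupp.induction_linear with
  | zero => simp [shift1]
  | add f g hf hg =>
    rw [shift1] at *
    rw [Finsupp.mapDomain_add, map_add, hf, hg, map_add, map_add]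
  | single n r =>
    rw [shift1, Finsupp.mapDomain_single, evalHom_single, evalHom_single, pow_succ',
      Module.End.mul_apply]

lemma evalHom_D1 (D : R →ₗ[ℂ] R) (F : R →ₗ[ℂ] P) (A C : Module.End ℂ P)
    (hC : ∀ r, F (D r) = C (F r)) (hAC : Commute C A) (f : Pol1 R) :
    evalHom F A (D1 D f) = C (evalHom F A f) := by
  induction f using Finsupp.induction_linear with
  | zero => simp [D1]
  | add f g hf hg =>
    rw [D1] at *
    rw [Finsupp.mapRange_add (fun a b => map_add D a b), map_add, hf, hg, map_add, map_add]
  | single n r =>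
    rw [D1, Finsupp.mapRange_single, evalHom_single, evalHom_single, hC,
      ← Module.End.mul_apply, ← Module.End.mul_apply, (hAC.pow_right n).eq]

lemma map_evalHom {Q : Type} [AddCommGroup Q] [Module ℂ Q] (F : R →ₗ[ℂ] P) (A : Module.End ℂ P)
    (S : P →ₗ[ℂ] Q) (A' : Module.End ℂ Q) (h : ∀ w, S (A w) = A' (S w)) (f : Pol1 R) :
    S (evalHom F A f) = evalHom (S.comp F) A' f := by
  have hpow : ∀ (n : ℕ) (w : P), S ((A ^ n) w) = (A' ^ n) (S w) := by
    intro n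
    induction n with
    | zero => simp
    | succ n ih => intro w; simp only [pow_succ', Module.End.mul_apply, h, ih]
  induction f using Finsupp.induction_linear with
  | zero => simp
  | add f g hf hg => simp only [map_add, hf, hg]
  | single n r => rw [evalHom_single, evalHom_single, hpow]; rfl

lemma subNeg_iterate_add (D : R →ₗ[ℂ] R) (n : ℕ) (f g : Pol1 R) :
    (subNeg D)^[n] (f + g) = (subNeg D)^[n] f + (subNeg D)^[n] g := by
  refine Function.Semiconj₂.iterate (f := subNeg D) (op := (· + ·)) (fun f g => ?_) n f g
  simp only [subNeg, D1, shift1, Finsupp.mapDomain_add,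
    Finsupp.mapRange_add (fun a b => map_add D a b)]
  abel

lemma subNeg_iterate_zero (D : R →ₗ[ℂ] R) (n : ℕ) : (subNeg D)^[n] 0 = 0 :=
  Function.iterate_fixed (by simp [subNeg, D1, shift1]) n

/-- Substituting `ν ↦ A` into `f(-∂-ν)` amounts to substituting `ν ↦ -∂-A` into `f`. -/
lemma evalHom_ev1_subNeg (D : R →ₗ[ℂ] R) (F : R →ₗ[ℂ] P) (A C : Module.End ℂ P)
    (hC : ∀ r, F (D r) = C (F r)) (hAC : Commute C A) (f : Pol1 R) :
    evalHom F A (ev1 f (subNeg D)) = evalHom F (-C - A) f := by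
  have hstep : ∀ g, evalHom F A (subNeg D g) = (-C - A) (evalHom F A g) := by
    intro g
    rw [subNeg, map_sub, map_neg, evalHom_shift1, evalHom_D1 D F A C hC hAC]
    rfl
  have hpow : ∀ (n : ℕ) g, evalHom F A ((subNeg D)^[n] g) = ((-C - A) ^ n) (evalHom F A g) := by
    intro n
    induction n with
    | zero => simp
    | succ n ih =>
      intro g
      rw [Function.iterate_succ_apply', hstep, ih, pow_succ', Module.End.mul_apply]
  induction f using Finsupp.induction_linear with
  | zero => simp [ev1]
  | add f g hf hg =>
    rw [map_add, ← hf, ← hg, ← map_add]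
    congr 1
    exact Finsupp.sum_add_index' (fun n => by rw [Finsupp.single_zero, subNeg_iterate_zero])
      (fun n r s => by rw [Finsupp.single_add, subNeg_iterate_add])
  | single n r =>
    rw [ev1, Finsupp.sum_single_index (by rw [Finsupp.single_zero, subNeg_iterate_zero]),
      hpow, evalHom_single, evalHom_single]
    simp

end Eval

lemma ev_eq_evalHom (f : Pol1 R) (A : Module.End ℂ (Pol3 R)) :
    ev f A = evalHom homIota A f := by
  simp only [ev, evalHom, Finsupp.lsum_apply]
  refine Finsupp.sum_congr fun n _ => ?_
  rw [← Module.End.coe_pow]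
  rfl

/-- `lift3` as an linear map. -/
noncomputable def lift3Hom (F : R →ₗ[ℂ] Pol3 R) : Pol3 R →ₗ[ℂ] Pol3 R :=
  Finsupp.lsum ℂ fun a => Finsupp.lsum ℂ fun b => Finsupp.lsum ℂ fun c =>
    (homL ^ a * (homM ^ b * homG ^ c)) ∘ₗ F

lemma lift3_eq_lift3Hom (F : R →ₗ[ℂ] Pol3 R) (w : Pol3 R) : lift3 F w = lift3Hom F w := by
  simp only [lift3, lift3Hom, Finsupp.lsum_apply]
  refine Finsupp.sum_congr fun a _ => Finsupp.sum_congr fun b _ => Finsupp.sum_congr fun c _ => ?_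
  change _ = (homL ^ a) ((homM ^ b) ((homG ^ c) (F _)))
  rw [Module.End.coe_pow, Module.End.coe_pow, Module.End.coe_pow]
  rfl

lemma lift3Hom_comp_homIota (F : R →ₗ[ℂ] Pol3 R) : (lift3Hom F).comp homIota = F := by
  ext1 r
  simp [lift3Hom, homIota]

lemma lift3Hom_homL (F : R →ₗ[ℂ] Pol3 R) (w : Pol3 R) :
    lift3Hom F (homL w) = homL (lift3Hom F w) := by
  induction w using Finsupp.induction_linear with
  | zero => simp
  | add f g hf hg => simp only [map_add, hf, hg]
  | single a x =>
  induction x using Finsupp.induction_linear with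
  | zero => simp
  | add f g hf hg => simp only [Finsupp.single_add, map_add, hf, hg]
  | single b y =>
  induction y using Finsupp.induction_linear with
  | zero => simp
  | add f g hf hg => simp only [Finsupp.single_add, map_add, hf, hg]
  | single c r =>
    have h : homL (Finsupp.single a (Finsupp.single b (Finsupp.single c r)))
        = Finsupp.single (a + 1) (Finsupp.single b (Finsupp.single c r)) := by
      simp [homL, Finsupp.mapDomain_single]
    rw [h]
    simp only [lift3Hom, Finsupp.lsum_single, LinearMap.comp_apply]
    rw [pow_succ', mul_assoc]
    rfl

lemma lift3Hom_homM (F : R →ₗ[ℂ] Pol3 R) (w : Pol3 R) :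
    lift3Hom F (homM w) = homM (lift3Hom F w) := by
  induction w using Finsupp.induction_linear with
  | zero => simp
  | add f g hf hg => simp only [map_add, hf, hg]
  | single a x =>
  induction x using Finsupp.induction_linear with
  | zero => simp
  | add f g hf hg => simp only [Finsupp.single_add, map_add, hf, hg]
  | single b y =>
  induction y using Finsupp.induction_linear with
  | zero => simp
  | add f g hf hg => simp only [Finsupp.single_add, map_add, hf, hg]
  | single c r =>
    have h : homM (Finsupp.single a (Finsupp.single b (Finsupp.single c r)))
        = Finsupp.single a (Finsupp.single (b + 1) (Finsupp.single c r)) := by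
      simp [homM, Finsupp.mapDomain_single]
    rw [h]
    simp only [lift3Hom, Finsupp.lsum_single, LinearMap.comp_apply]
    rw [pow_succ', mul_assoc, ← mul_assoc (homL ^ a), (commute_homL_homM.pow_left a).eq,
      mul_assoc]
    rfl

lemma lift3_ev_homL (F : R →ₗ[ℂ] Pol3 R) (f : Pol1 R) :
    lift3 F (ev f (homL : Module.End ℂ (Pol3 R))) = evalHom F homL f := by
  rw [ev_eq_evalHom, lift3_eq_lift3Hom, map_evalHom _ _ _ homL (lift3Hom_homL F),
    lift3Hom_comp_homIota]

lemma lift3_ev_homM (F : R →ₗ[ℂ] Pol3 R) (f : Pol1 R) :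
    lift3 F (ev f (homM : Module.End ℂ (Pol3 R))) = evalHom F homM f := by
  rw [ev_eq_evalHom, lift3_eq_lift3Hom, map_evalHom _ _ _ homM (lift3Hom_homM F),
    lift3Hom_comp_homIota]

/-- The substitution `λ ↦ E` in `R[λ,μ,γ]`. -/
noncomputable def substL (E : Module.End ℂ (Pol3 R)) : Pol3 R →ₗ[ℂ] Pol3 R :=
  evalHom (Finsupp.lsingle 0) E

lemma substL_comp_homIota (E : Module.End ℂ (Pol3 R)) :
    (substL E).comp homIota = homIota := by
  ext1 r
  simp [substL, homIota, evalHom_single]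

lemma substL_homL (E : Module.End ℂ (Pol3 R)) (w : Pol3 R) :
    substL E (homL w) = E (substL E w) :=
  evalHom_shift1 _ E w

lemma substL_homM (E : Module.End ℂ (Pol3 R)) (hE : Commute homM E) (w : Pol3 R) :
    substL E (homM w) = homM (substL E w) := by
  induction w using Finsupp.induction_linear with
  | zero => simp
  | add f g hf hg => simp only [map_add, hf, hg]
  | single a x =>
    have h : ∀ a, homM (Finsupp.single a x) = Finsupp.single a (Finsupp.mapDomain (· + 1) x) := by
      intro a
      simp [homM]
    rw [h, substL, evalHom_single, evalHom_single, Finsupp.lsingle_apply,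
      Finsupp.lsingle_apply, ← h, ← Module.End.mul_apply, ← Module.End.mul_apply,
      (hE.pow_right a).eq]

section Biadditive

variable {D : R →ₗ[ℂ] R} {φ : R → R → Pol1 R}

/-- The linear map `r ↦ φ_A(x, r)`. -/
noncomputable def IsConfBilinear.evRight (h : IsConfBilinear D φ) (x : R)
    (A : Module.End ℂ (Pol3 R)) : R →ₗ[ℂ] Pol3 R :=
  evalHom homIota A ∘ₗ 
    ({ toFun := φ x
       map_add' := h.add_right x
       map_smul' := fun c => h.smul_right c x } : R →ₗ[ℂ] Pol1 R)

/-- The linear map `r ↦ φ_A(r, y)`. -/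
noncomputable def IsConfBilinear.evLeft (h : IsConfBilinear D φ) (y : R)
    (A : Module.End ℂ (Pol3 R)) : R →ₗ[ℂ] Pol3 R :=
  evalHom homIota A ∘ₗ 
    ({ toFun := (φ · y)
       map_add' := (h.add_left · · y)
       map_smul' := (h.smul_left · · y) } : R →ₗ[ℂ] Pol1 R)

lemma IsConfBilinear.coe_evRight (h : IsConfBilinear D φ) (x : R)
    (A : Module.End ℂ (Pol3 R)) : (fun r => ev (φ x r) A) = h.evRight x A :=
  funext fun _ => ev_eq_evalHom _ A

lemma IsConfBilinear.coe_evLeft (h : IsConfBilinear D φ) (y : R)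
    (A : Module.End ℂ (Pol3 R)) : (fun r => ev (φ r y) A) = h.evLeft y A :=
  funext fun _ => ev_eq_evalHom _ A

lemma IsConfBilinear.evRight_D (h : IsConfBilinear D φ) (x : R) (A : Module.End ℂ (Pol3 R))
    (hA : Commute (homD D) A) (r : R) :
    h.evRight x A (D r) = (homD D + A) (h.evRight x A r) := by
  change evalHom homIota A (φ x (D r)) = _
  rw [h.d_right, map_add, evalHom_shift1,
    evalHom_D1 D homIota A (homD D) (fun r => (homD_homIota D r).symm) hA]
  rfl

lemma IsConfBilinear.evLeft_eq_neg_evRight (h : IsConfBilinear D φ) (hs : IsSkew D φ) (y : R)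
    (A : Module.End ℂ (Pol3 R)) (hA : Commute (homD D) A) :
    h.evLeft y A = -h.evRight y (-homD D - A) := by
  ext1 r
  change evalHom homIota A (φ r y) = -evalHom homIota _ (φ y r)
  rw [hs r y, map_neg,
    evalHom_ev1_subNeg D homIota A (homD D) (fun r => (homD_homIota D r).symm) hA]

/-- Skew-symmetry of the inner operation in a composite `[x_A ψ_μ(y, z)]`. -/
lemma IsConfBilinear.evalHom_evRight_skew (h : IsConfBilinear D φ) {ψ : R → R → Pol1 R}
    (hs : IsSkew D ψ) (x y z : R) (A A' : Module.End ℂ (Pol3 R)) (hA : Commute (homD D) A)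
    (hA' : Commute (homD D) A') (hAA' : Commute A A') :
    evalHom (h.evRight x A) A' (ψ y z)
      = -evalHom (h.evRight x A) (-homD D - A - A') (ψ z y) := by
  rw [hs y z, map_neg, evalHom_ev1_subNeg D _ A' (homD D + A) (h.evRight_D x A hA)
    (hA'.add_left hAA'), neg_add']

lemma evalHom_neg {P : Type} [AddCommGroup P] [Module ℂ P] (F : R →ₗ[ℂ] P) (A : Module.End ℂ P) (f : Pol1 R) :
    evalHom (-F) A f = -evalHom F A f := by
  induction f using Finsupp.induction_linear with
  | zero => simp
  | add f g hf hg => rw [map_add, hf, hg, map_add, neg_add]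
  | single n r => simp [evalHom_single]

lemma IsConfBilinear.substL_comp_evRight (h : IsConfBilinear D φ) (x : R)
    (E A A' : Module.End ℂ (Pol3 R)) (hA : ∀ w, substL E (A w) = A' (substL E w)) :
    (substL E).comp (h.evRight x A) = h.evRight x A' := by
  ext1 r
  change substL E (evalHom homIota A (φ x r)) = evalHom homIota A' (φ x r)
  rw [map_evalHom _ _ _ A' hA, substL_comp_homIota]

lemma IsConfBilinear.substL_comp_evLeft (h : IsConfBilinear D φ) (y : R)
    (E A A' : Module.End ℂ (Pol3 R)) (hA : ∀ w, substL E (A w) = A' (substL E w)) :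
    (substL E).comp (h.evLeft y A) = h.evLeft y A' := by
  ext1 r
  change substL E (evalHom homIota A (φ r y)) = evalHom homIota A' (φ r y)
  rw [map_evalHom _ _ _ A' hA, substL_comp_homIota]

end Biadditive

/-- if `φ` is a conformal biderivation of a Lie conformal algebra `R`, then
`φ_{λ+μ}([x_μ y], z) = [x_μ φ_λ(y,z)] - [y_λ φ_μ(x,z)]` for all `x, y, z ∈ R`. -/
theorem biderivation_lem1 {R : Type} [AddCommGroup R] [Module ℂ R]
    (D : R →ₗ[ℂ] R) (B : R → R → Pol1 R) (hR : IsLieConformal D B)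
    (φ : R → R → Pol1 R) (hφ : IsConfBiderivation D B φ) :
    ∀ x y z : R,
      lift3 (fun r => ev (φ r z) eLM) (ev (B x y) Xm)
        = lift3 (fun r => ev (B x r) Xm) (ev (φ y z) Xl)
          - lift3 (fun r => ev (B y r) Xl) (ev (φ x z) Xm) := by
  intro x y z
  have hXl : (Xl : Pol3 R → Pol3 R) = (homL : Module.End ℂ (Pol3 R)) := rfl
  have hXm : (Xm : Pol3 R → Pol3 R) = (homM : Module.End ℂ (Pol3 R)) := rfl
  have heLM : (eLM : Pol3 R → Pol3 R) = (homL + homM : Module.End ℂ (Pol3 R)) := rfl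
  have hDL := commute_homD_homL D
  have hDM := commute_homD_homM D
  have hLM : Commute (homL : Module.End ℂ (Pol3 R)) homM := commute_homL_homM
  set E : Module.End ℂ (Pol3 R) := -homD D - (homL + homM) with hE
  have hME : Commute homM E :=
    hDM.symm.neg_right.sub_right (hLM.symm.add_right (Commute.refl _))
  have hSL := substL_homL E
  have hSM := substL_homM E hME
  have hSLM : ∀ w, substL E ((homL + homM : Module.End ℂ (Pol3 R)) w)
      = (-homD D - homL : Module.End ℂ (Pol3 R)) (substL E w) := by
    intro w
    have : (-homD D - homL : Module.End ℂ (Pol3 R)) = E + homM := by rw [hE]; abel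
    rw [this, LinearMap.add_apply, LinearMap.add_apply, map_add, hSL, hSM]
  have key := congrArg (substL E) (hφ.leibniz z x y)
  rw [hXl, hXm, heLM, hφ.bilin.coe_evRight, hR.bilin.coe_evRight, hR.bilin.coe_evLeft,
    lift3_ev_homM, lift3_ev_homL, lift3_ev_homL, map_add,
    map_evalHom _ _ _ homM hSM, map_evalHom _ _ _ E hSL, map_evalHom _ _ _ E hSL,
    hφ.bilin.substL_comp_evRight z E homL E hSL, hR.bilin.substL_comp_evRight x E homM homM hSM,
    hR.bilin.substL_comp_evLeft y E _ _ hSLM,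
    hR.bilin.evLeft_eq_neg_evRight hR.skew y _
      ((Commute.refl (homD D)).neg_right.sub_right hDL), evalHom_neg] at key
  rw [hXl, hXm, heLM, hφ.bilin.coe_evLeft, hR.bilin.coe_evRight, hR.bilin.coe_evRight,
    lift3_ev_homM, lift3_ev_homL, lift3_ev_homM,
    hφ.bilin.evLeft_eq_neg_evRight hφ.skew z _ (hDL.add_right hDM), evalHom_neg, key,
    hR.bilin.evalHom_evRight_skew hφ.skew x y z homM homL hDM hDL hLM.symm,
    hR.bilin.evalHom_evRight_skew hφ.skew y x z homL homM hDL hDM hLM]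
  have h1 : -homD D - homM - homL = E := by rw [hE]; abel
  have h2 : -homD D - homL - homM = E := by rw [hE]; abel
  have h3 : -homD D - (-homD D - homL) = (homL : Module.End ℂ (Pol3 R)) := by abel
  rw [h1, h2, h3]
  abel

end ConfBider
end

section
/- Let R be a Lie conformal algebra and let φ be a skew-symmetric conformal bilinear map on R satisfying φ_{λ+μ}([x_μ y], z) = [x_μ φ_λ(y,z)] - [y_λ φ_μ(x,z)] for all x, y, z ∈ R. Then φ satisfies the biderivation identity φ_λ(x,[y_μ z]) = [(φ_λ(x,y))_{λ+μ} z] + [y_μ φ_λ(x,z)] for all x, y, z ∈ R. -/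
/- Framework: a Lie conformal algebra over ℂ is a ℂ[∂]-module `R` (given by a ℂ-module
with a ℂ-linear operator `D` for the action of `∂`) with a λ-bracket `B : R → R → R[λ]`.
We model `R[λ]` as `ℕ →₀ R` (coefficient of `λ^n` at index `n`) and `R[λ,μ,γ]` as an
iterated Finsupp.  Substitutions of the bracket variable are implemented by evaluating
the polynomial at a commuting operator (e.g. multiplication by `λ`, by `λ+μ`, or by
`-∂-λ`), and brackets/biderivations are extended to polynomial-valued arguments by
ℂ[λ,μ,γ]-bilinearity. -/

namespace ConfBider

variable {R : Type} [AddCommGroup R] [Module ℂ R]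

section Substitution

variable {A V W : Type*} [AddCommMonoid A] [AddCommMonoid V] [AddCommMonoid W]
  [Module ℂ A] [Module ℂ V] [Module ℂ W]

/-- The linear map `∑ aₙ νⁿ ↦ ∑ eⁿ (F aₙ)`. -/
noncomputable def substHom (F : A →ₗ[ℂ] V) (e : Module.End ℂ V) : (ℕ →₀ A) →ₗ[ℂ] V :=
  Finsupp.lsum ℕ fun n => (e ^ n) ∘ₗ F

/-- Multiplication by the variable, as an endomorphism of `A[ν]`. -/
noncomputable def shiftEnd (A : Type*) [AddCommMonoid A] [Module ℂ A] : Module.End ℂ (ℕ →₀ A) :=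
  Finsupp.lmapDomain A ℂ (· + 1)

/-- The coefficientwise action of an endomorphism on `A[ν]`. -/
noncomputable def coeffEnd (d : Module.End ℂ A) : Module.End ℂ (ℕ →₀ A) :=
  Finsupp.mapRange.linearMap d

@[simp]
lemma shiftEnd_single (n : ℕ) (a : A) :
    shiftEnd A (Finsupp.single n a) = Finsupp.single (n + 1) a :=
  Finsupp.mapDomain_single

@[simp]
lemma coeffEnd_single (d : Module.End ℂ A) (n : ℕ) (a : A) :
    coeffEnd d (Finsupp.single n a) = Finsupp.single n (d a) :=
  Finsupp.mapRange_single (hf := map_zero d)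

lemma commute_shiftEnd_coeffEnd (d : Module.End ℂ A) : Commute (shiftEnd A) (coeffEnd d) := by
  refine Finsupp.lhom_ext fun n a => ?_
  simp [Module.End.mul_apply]

lemma commute_coeffEnd {d d' : Module.End ℂ A} (h : Commute d d') :
    Commute (coeffEnd d) (coeffEnd d') := by
  refine Finsupp.lhom_ext fun n a => ?_
  have := DFunLike.congr_fun h.eq a
  simp only [Module.End.mul_apply] at this
  simp [Module.End.mul_apply, this]

lemma substHom_apply (F : A →ₗ[ℂ] V) (e : Module.End ℂ V) (f : ℕ →₀ A) :
    substHom F e f = f.sum fun n a => e^[n] (F a) := by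
  simp [substHom, Module.End.coe_pow, Function.comp_def]

@[simp]
lemma substHom_single (F : A →ₗ[ℂ] V) (e : Module.End ℂ V) (n : ℕ) (a : A) :
    substHom F e (Finsupp.single n a) = (e ^ n) (F a) := by
  simp [substHom]

/-- A map intertwining `e` and `e'` carries substitution of `e` to substitution of `e'`. -/
lemma map_substHom (Φ : V →ₗ[ℂ] W) {e : Module.End ℂ V} {e' : Module.End ℂ W}
    (h : ∀ v, Φ (e v) = e' (Φ v)) (F : A →ₗ[ℂ] V) (f : ℕ →₀ A) :
    Φ (substHom F e f) = substHom (Φ ∘ₗ F) e' f := by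
  have key : Φ ∘ₗ substHom F e = substHom (Φ ∘ₗ F) e' := by
    refine Finsupp.lhom_ext fun n a => ?_
    have : ∀ v, Φ ((e ^ n) v) = (e' ^ n) (Φ v) := by
      rw [Module.End.coe_pow, Module.End.coe_pow]
      exact (show Function.Semiconj Φ e e' from h).iterate_right n
    simp [this]
  exact DFunLike.congr_fun key f

lemma substHom_shiftEnd (F : A →ₗ[ℂ] V) (e : Module.End ℂ V) (f : ℕ →₀ A) :
    substHom F e (shiftEnd A f) = e (substHom F e f) := by
  have key : substHom F e ∘ₗ shiftEnd A = e ∘ₗ substHom F e := by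
    refine Finsupp.lhom_ext fun n a => ?_
    simp [pow_succ', Module.End.mul_apply]
  exact DFunLike.congr_fun key f

lemma substHom_coeffEnd {F : A →ₗ[ℂ] V} {e T : Module.End ℂ V} {d : Module.End ℂ A}
    (hF : ∀ a, F (d a) = T (F a)) (hT : Commute T e) (f : ℕ →₀ A) :
    substHom F e (coeffEnd d f) = T (substHom F e f) := by
  have key : substHom F e ∘ₗ coeffEnd d = T ∘ₗ substHom F e := by
    refine Finsupp.lhom_ext fun n a => ?_
    have := DFunLike.congr_fun (hT.pow_right n).eq (F a)
    simp only [Module.End.mul_apply] at this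
    simp [hF, this]
  exact DFunLike.congr_fun key f

/-- Substitution of three operators for the variables of `A[λ,μ,γ]`. -/
noncomputable def substHom₃ (F : A →ₗ[ℂ] V) (l m g : Module.End ℂ V) :
    (ℕ →₀ ℕ →₀ ℕ →₀ A) →ₗ[ℂ] V :=
  substHom (substHom (substHom F g) m) l

variable {F : A →ₗ[ℂ] V} {l m g : Module.End ℂ V}

lemma substHom₃_single (a : A) :
    substHom₃ F l m g (Finsupp.single 0 (Finsupp.single 0 (Finsupp.single 0 a))) = F a := by
  simp [substHom₃]

lemma substHom₃_shiftEnd (w : ℕ →₀ ℕ →₀ ℕ →₀ A) :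
    substHom₃ F l m g (shiftEnd _ w) = l (substHom₃ F l m g w) :=
  substHom_shiftEnd _ _ _

lemma substHom₃_coeffEnd_shiftEnd (h : Commute m l) (w : ℕ →₀ ℕ →₀ ℕ →₀ A) :
    substHom₃ F l m g (coeffEnd (shiftEnd _) w) = m (substHom₃ F l m g w) :=
  substHom_coeffEnd (substHom_shiftEnd _ _) h w

end Substitution

section Operators

/-- A copy of `R[λ,μ,γ]` whose additive group structure is found by a direct instance. -/
def TriPoly (R : Type) [AddCommGroup R] : Type := Pol3 R

noncomputable instance (R : Type) [AddCommGroup R] : AddCommGroup (TriPoly R) :=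
  inferInstanceAs (AddCommGroup (Pol3 R))

noncomputable instance (R : Type) [AddCommGroup R] [Module ℂ R] : Module ℂ (TriPoly R) :=
  inferInstanceAs (Module ℂ (Pol3 R))

/-- `iota3` as a linear map. -/
noncomputable def iotaHom (R : Type) [AddCommGroup R] [Module ℂ R] : R →ₗ[ℂ] TriPoly R :=
  Finsupp.lsingle 0 ∘ₗ Finsupp.lsingle 0 ∘ₗ Finsupp.lsingle 0

/-- Multiplication by `λ` on `R[λ,μ,γ]`, as an endomorphism. -/
noncomputable def lamEnd (R : Type) [AddCommGroup R] [Module ℂ R] : Module.End ℂ (TriPoly R) :=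
  shiftEnd _

/-- Multiplication by `μ` on `R[λ,μ,γ]`, as an endomorphism. -/
noncomputable def muEnd (R : Type) [AddCommGroup R] [Module ℂ R] : Module.End ℂ (TriPoly R) :=
  coeffEnd (shiftEnd _)

/-- Multiplication by `γ` on `R[λ,μ,γ]`, as an endomorphism. -/
noncomputable def gamEnd (R : Type) [AddCommGroup R] [Module ℂ R] : Module.End ℂ (TriPoly R) :=
  coeffEnd (coeffEnd (shiftEnd _))

/-- The action of `∂` on coefficients of `R[λ,μ,γ]`. -/
noncomputable def derEnd (D : R →ₗ[ℂ] R) : Module.End ℂ (TriPoly R) :=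
  coeffEnd (coeffEnd (coeffEnd D))

/-- Evaluation of a polynomial at an endomorphism of `R[λ,μ,γ]`. -/
noncomputable def evHom (e : Module.End ℂ (TriPoly R)) : Pol1 R →ₗ[ℂ] TriPoly R :=
  substHom (iotaHom R) e

lemma ev_eq_evHom (f : Pol1 R) (e : Module.End ℂ (TriPoly R)) : ev f e = evHom e f :=
  (substHom_apply (iotaHom R) e f).symm

lemma commute_lamEnd_muEnd : Commute (lamEnd R) (muEnd R) := commute_shiftEnd_coeffEnd _

lemma commute_lamEnd_derEnd (D : R →ₗ[ℂ] R) : Commute (lamEnd R) (derEnd D) :=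
  commute_shiftEnd_coeffEnd _

lemma commute_muEnd_derEnd (D : R →ₗ[ℂ] R) : Commute (muEnd R) (derEnd D) :=
  commute_coeffEnd (commute_shiftEnd_coeffEnd _)

lemma derEnd_iotaHom (D : R →ₗ[ℂ] R) (r : R) : iotaHom R (D r) = derEnd D (iotaHom R r) := by
  change _ = coeffEnd (coeffEnd (coeffEnd D))
    (Finsupp.single 0 (Finsupp.single 0 (Finsupp.single 0 r)))
  simp only [coeffEnd_single]
  rfl

lemma lift3_eq_substHom₃ {F' : R → Pol3 R} {F : R →ₗ[ℂ] TriPoly R} (hF : ∀ r, F' r = F r)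
    (w : Pol3 R) : lift3 F' w = substHom₃ F (lamEnd R) (muEnd R) (gamEnd R) w := by
  have hl (n : ℕ) : (Xl : Pol3 R → Pol3 R)^[n] = ⇑(lamEnd R ^ n) :=
    (Module.End.coe_pow (lamEnd R) n).symm
  have hm (n : ℕ) : (Xm : Pol3 R → Pol3 R)^[n] = ⇑(muEnd R ^ n) :=
    (Module.End.coe_pow (muEnd R) n).symm
  have hg (n : ℕ) : (Xg : Pol3 R → Pol3 R)^[n] = ⇑(gamEnd R ^ n) :=
    (Module.End.coe_pow (gamEnd R) n).symm
  obtain rfl : F' = F := funext hF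
  simp only [lift3, hl, hm, hg, substHom₃, substHom, Finsupp.lsum_apply, Finsupp.sum,
    LinearMap.comp_apply, map_sum]
  rfl

lemma lift3_ev {F' : R → Pol3 R} {F : R →ₗ[ℂ] TriPoly R} (hF : ∀ r, F' r = F r)
    {e : Module.End ℂ (TriPoly R)}
    (he : ∀ w : Pol3 R, substHom₃ F (lamEnd R) (muEnd R) (gamEnd R) (e w) =
      e (substHom₃ F (lamEnd R) (muEnd R) (gamEnd R) w)) (f : Pol1 R) :
    lift3 F' (ev f e) = substHom F e f := by
  let Φ : TriPoly R →ₗ[ℂ] TriPoly R := substHom₃ F (lamEnd R) (muEnd R) (gamEnd R)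
  have hΦ : Φ ∘ₗ iotaHom R = F := LinearMap.ext fun r => substHom₃_single r
  have h : lift3 F' (ev f e) = Φ (evHom e f) := by
    rw [lift3_eq_substHom₃ hF, ev_eq_evHom]
    rfl
  rw [h, evHom, map_substHom Φ he, hΦ]

lemma lift3_ev_Xl {F' : R → Pol3 R} {F : R →ₗ[ℂ] TriPoly R} (hF : ∀ r, F' r = F r) (f : Pol1 R) :
    lift3 F' (ev f Xl) = substHom F (lamEnd R) f :=
  lift3_ev hF substHom₃_shiftEnd f

lemma lift3_ev_Xm {F' : R → Pol3 R} {F : R →ₗ[ℂ] TriPoly R} (hF : ∀ r, F' r = F r) (f : Pol1 R) :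
    lift3 F' (ev f Xm) = substHom F (muEnd R) f :=
  lift3_ev hF (substHom₃_coeffEnd_shiftEnd commute_lamEnd_muEnd.symm) f

/-- Substituting `-∂-ν` for `ν` and then `e` for `ν` amounts to substituting `-T-e`, where `T` is
the operator through which `∂` acts after `F`. -/
lemma substHom_ev1_subNeg {V : Type*} [AddCommGroup V] [Module ℂ V] {D : R →ₗ[ℂ] R}
    {F : R →ₗ[ℂ] V} {e T : Module.End ℂ V} (hF : ∀ r, F (D r) = T (F r)) (hT : Commute T e)
    (f : Pol1 R) : substHom F e (ev1 f (subNeg D)) = substHom F (-T - e) f := by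
  have h : ev1 f (subNeg D) = substHom (Finsupp.lsingle 0) (-coeffEnd D - shiftEnd R) f :=
    (substHom_apply (Finsupp.lsingle 0) (-coeffEnd D - shiftEnd R) f).symm
  have hF₀ : substHom F e ∘ₗ Finsupp.lsingle 0 = F :=
    LinearMap.ext fun r => substHom_single F e 0 r
  rw [h, map_substHom (e' := -T - e), hF₀]
  · intro v
    have h1 := substHom_coeffEnd hF hT v
    have h2 := substHom_shiftEnd F e v
    change substHom F e (-(coeffEnd D v) - shiftEnd R v) =
      -(T (substHom F e v)) - e (substHom F e v)
    rw [map_sub, map_neg, h1, h2]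

/-- The substitution `λ ↦ -∂-λ-μ` on `R[λ,μ,γ]`. -/
noncomputable def flipHom (D : R →ₗ[ℂ] R) : TriPoly R →ₗ[ℂ] TriPoly R :=
  substHom₃ (iotaHom R) (-derEnd D - (lamEnd R + muEnd R)) (muEnd R) (gamEnd R)

lemma flipHom_comp_iotaHom (D : R →ₗ[ℂ] R) : flipHom D ∘ₗ iotaHom R = iotaHom R := by
  ext r : 1
  exact substHom₃_single r

lemma flipHom_lamEnd (D : R →ₗ[ℂ] R) (w : TriPoly R) :
    flipHom D (lamEnd R w) = (-derEnd D - (lamEnd R + muEnd R)) (flipHom D w) :=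
  substHom₃_shiftEnd w

lemma flipHom_muEnd (D : R →ₗ[ℂ] R) (w : TriPoly R) :
    flipHom D (muEnd R w) = muEnd R (flipHom D w) :=
  substHom₃_coeffEnd_shiftEnd ((commute_muEnd_derEnd D).neg_right.sub_right
    (commute_lamEnd_muEnd.symm.add_right (Commute.refl _))) w

lemma flipHom_lamEnd_add_muEnd (D : R →ₗ[ℂ] R) (w : TriPoly R) :
    flipHom D ((lamEnd R + muEnd R) w) = (-derEnd D - lamEnd R) (flipHom D w) := by
  rw [LinearMap.add_apply, map_add, flipHom_lamEnd, flipHom_muEnd,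
    ← LinearMap.add_apply]
  congr 1
  abel

lemma flipHom_evHom (D : R →ₗ[ℂ] R) {e e' : Module.End ℂ (TriPoly R)}
    (h : ∀ w, flipHom D (e w) = e' (flipHom D w)) (f : Pol1 R) :
    flipHom D (evHom e f) = evHom e' f := by
  rw [evHom, map_substHom _ h, flipHom_comp_iotaHom, evHom]

end Operators

section Bilinear

variable {D : R →ₗ[ℂ] R} {φ : R → R → Pol1 R}

/-- `x ↦ φ_λ(x, z)` as a linear map. -/
noncomputable def IsConfBilinear.leftHom (h : IsConfBilinear D φ) (z : R) : R →ₗ[ℂ] Pol1 R :=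
  { toFun x := φ x z
    map_add' x x' := h.add_left x x' z
    map_smul' c x := h.smul_left c x z }

/-- `y ↦ φ_λ(x, y)` as a linear map. -/
noncomputable def IsConfBilinear.rightHom (h : IsConfBilinear D φ) (x : R) : R →ₗ[ℂ] Pol1 R :=
  { toFun := φ x
    map_add' := h.add_right x
    map_smul' c := h.smul_right c x }

@[simp]
lemma IsConfBilinear.leftHom_apply (h : IsConfBilinear D φ) (x z : R) :
    h.leftHom z x = φ x z := rfl

@[simp]
lemma IsConfBilinear.rightHom_apply (h : IsConfBilinear D φ) (x y : R) :
    h.rightHom x y = φ x y := rfl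

lemma IsConfBilinear.evHom_left (h : IsConfBilinear D φ) (e : Module.End ℂ (TriPoly R)) (x z : R) :
    evHom e (φ (D x) z) = (-e) (evHom e (φ x z)) := by
  rw [h.d_left, map_neg]
  exact congrArg Neg.neg (substHom_shiftEnd _ e (φ x z))

lemma IsConfBilinear.evHom_right (h : IsConfBilinear D φ) {e : Module.End ℂ (TriPoly R)}
    (he : Commute (derEnd D) e) (x y : R) :
    evHom e (φ x (D y)) = (derEnd D + e) (evHom e (φ x y)) := by
  rw [h.d_right, map_add]
  exact congrArg₂ (· + ·)
    (substHom_coeffEnd (derEnd_iotaHom D) he (φ x y))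
    (substHom_shiftEnd _ e (φ x y))

lemma IsSkew.evHom (h : IsSkew D φ) {e : Module.End ℂ (TriPoly R)} (he : Commute (derEnd D) e)
    (x y : R) : evHom e (φ x y) = -evHom (-derEnd D - e) (φ y x) := by
  rw [h x y, map_neg]
  exact congrArg Neg.neg (substHom_ev1_subNeg (derEnd_iotaHom D) he _)

end Bilinear

/-- a skew-symmetric conformal bilinear map `φ` on a Lie conformal algebra
satisfying `φ_{λ+μ}([x_μ y], z) = [x_μ φ_λ(y,z)] - [y_λ φ_μ(x,z)]` satisfies the
biderivation identity `φ_λ(x,[y_μ z]) = [(φ_λ(x,y))_{λ+μ} z] + [y_μ φ_λ(x,z)]`. -/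
theorem lem1_implies_leibniz {R : Type} [AddCommGroup R] [Module ℂ R]
    (D : R →ₗ[ℂ] R) (B : R → R → Pol1 R) (hR : IsLieConformal D B)
    (φ : R → R → Pol1 R) (hbil : IsConfBilinear D φ) (hskew : IsSkew D φ)
    (hlem : ∀ x y z : R,
      lift3 (fun r => ev (φ r z) eLM) (ev (B x y) Xm)
        = lift3 (fun r => ev (B x r) Xm) (ev (φ y z) Xl)
          - lift3 (fun r => ev (B y r) Xl) (ev (φ x z) Xm)) :
    ∀ x y z : R,
      lift3 (fun r => ev (φ x r) Xl) (ev (B y z) Xm)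
        = lift3 (fun r => ev (B r z) eLM) (ev (φ x y) Xl)
          + lift3 (fun r => ev (B y r) Xm) (ev (φ x z) Xl) := by
  intro x y z
  have hB := hR.bilin
  have hPL := (commute_lamEnd_derEnd D).symm
  have hPM := (commute_muEnd_derEnd D).symm
  have hLM : Commute (lamEnd R) (muEnd R) := commute_lamEnd_muEnd
  have hlem' : substHom (evHom (lamEnd R + muEnd R) ∘ₗ hbil.leftHom x) (muEnd R) (B y z)
      = substHom (evHom (muEnd R) ∘ₗ hB.rightHom y) (lamEnd R) (φ z x)
        - substHom (evHom (lamEnd R) ∘ₗ hB.rightHom z) (muEnd R) (φ y x) := by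
    refine (lift3_ev_Xm (fun r => ev_eq_evHom _ (lamEnd R + muEnd R)) (B y z)).symm.trans
      ((hlem y z x).trans (congrArg₂ (· - ·) ?_ ?_))
    · exact lift3_ev_Xl (fun r => ev_eq_evHom _ (muEnd R)) (φ z x)
    · exact lift3_ev_Xm (fun r => ev_eq_evHom _ (lamEnd R)) (φ y x)
  replace hlem' := congrArg (flipHom D) hlem'
  rw [map_sub, map_substHom _ (flipHom_muEnd D), map_substHom _ (flipHom_lamEnd D),
    map_substHom _ (flipHom_muEnd D)] at hlem'
  have hleft : flipHom D ∘ₗ (evHom (lamEnd R + muEnd R) ∘ₗ hbil.leftHom x)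
      = -evHom (lamEnd R) ∘ₗ hbil.rightHom x := by
    ext r : 1
    simp [flipHom_evHom D (flipHom_lamEnd_add_muEnd D), hskew.evHom hPL x r]
  have hmid : flipHom D ∘ₗ (evHom (muEnd R) ∘ₗ hB.rightHom y)
      = evHom (muEnd R) ∘ₗ hB.rightHom y := by
    ext r : 1
    simp [flipHom_evHom D (flipHom_muEnd D)]
  have hright : flipHom D ∘ₗ (evHom (lamEnd R) ∘ₗ hB.rightHom z)
      = -evHom (lamEnd R + muEnd R) ∘ₗ hB.leftHom z := by
    ext r : 1
    simp [flipHom_evHom D (flipHom_lamEnd D), hR.skew.evHom (hPL.add_right hPM) r z]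
  have substHom_neg (F : R →ₗ[ℂ] TriPoly R) (e : Module.End ℂ (TriPoly R)) (f : Pol1 R) :
      substHom (-F) e f = -substHom F e f := by
    simp [substHom_apply, Finsupp.sum, iterate_map_neg]
  have hxz : substHom (evHom (muEnd R) ∘ₗ hB.rightHom y) (lamEnd R) (φ x z)
      = -substHom (evHom (muEnd R) ∘ₗ hB.rightHom y)
          (-derEnd D - (lamEnd R + muEnd R)) (φ z x) := by
    rw [hskew x z, map_neg, substHom_ev1_subNeg (T := derEnd D + muEnd R)
      (fun r => hB.evHom_right hPM y r) (hPL.add_left hLM.symm)]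
    congr 3
    abel
  have hxy : substHom (evHom (lamEnd R + muEnd R) ∘ₗ hB.leftHom z) (lamEnd R) (φ x y)
      = -substHom (evHom (lamEnd R + muEnd R) ∘ₗ hB.leftHom z) (muEnd R) (φ y x) := by
    rw [hskew x y, map_neg, substHom_ev1_subNeg (T := -(lamEnd R + muEnd R))
      (fun r => hB.evHom_left _ r z) ((Commute.refl _).add_left hLM.symm).neg_left]
    congr 3
    abel
  rw [hleft, hmid, hright, substHom_neg, substHom_neg] at hlem'
  have hgoal : substHom (evHom (lamEnd R) ∘ₗ hbil.rightHom x) (muEnd R) (B y z)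
      = substHom (evHom (lamEnd R + muEnd R) ∘ₗ hB.leftHom z) (lamEnd R) (φ x y)
        + substHom (evHom (muEnd R) ∘ₗ hB.rightHom y) (lamEnd R) (φ x z) := by
    rw [hxz, hxy, ← neg_inj, hlem']
    abel
  refine (lift3_ev_Xm (fun r => ev_eq_evHom _ (lamEnd R)) (B y z)).trans
    (hgoal.trans (congrArg₂ (· + ·) ?_ ?_))
  · exact (lift3_ev_Xl (fun r => ev_eq_evHom _ (lamEnd R + muEnd R)) (φ x y)).symm
  · exact (lift3_ev_Xl (fun r => ev_eq_evHom _ (muEnd R)) (φ x z)).symm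

end ConfBider
end

section
/- Let R be a Lie conformal algebra and let φ be a conformal biderivation of R. If x, y ∈ R satisfy [x_λ y] = 0, then φ_λ(x,y) lies in the set of elements z ∈ R[λ] such that [z_{λ+μ} w] = 0 for all w of the form [u_μ v] with u, v ∈ R (i.e., φ_λ(x,y) centralizes all λ-brackets). -/
/- Framework: a Lie conformal algebra over ℂ is a ℂ[∂]-module `R` (given by a ℂ-module
with a ℂ-linear operator `D` for the action of `∂`) with a λ-bracket `B : R → R → R[λ]`.
We model `R[λ]` as `ℕ →₀ R` (coefficient of `λ^n` at index `n`) and `R[λ,μ,γ]` as an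
iterated Finsupp.  Substitutions of the bracket variable are implemented by evaluating
the polynomial at a commuting operator (e.g. multiplication by `λ`, by `λ+μ`, or by
`-∂-λ`), and brackets/biderivations are extended to polynomial-valued arguments by
ℂ[λ,μ,γ]-bilinearity. -/

namespace ConfBider

variable {R : Type} [AddCommGroup R] [Module ℂ R]

section OperatorEvaluation

variable {M N : Type} [AddCommGroup M] [Module ℂ M] [AddCommGroup N] [Module ℂ N]

/-- Substitution of a linear operator `A` on the left of the coefficients: `∑ Aⁿ fₙ`. -/
noncomputable def opEval (A : Module.End ℂ M) : Pol1 M →ₗ[ℂ] M :=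
  Finsupp.lsum ℂ fun n => A ^ n

/-- Evaluation of a polynomial with coefficients in `M` at a scalar. -/
noncomputable def evalAt (c : ℂ) : Pol1 M →ₗ[ℂ] M :=
  opEval (algebraMap ℂ (Module.End ℂ M) c)

theorem opEval_apply (A : Module.End ℂ M) (f : Pol1 M) :
    opEval A f = f.sum fun n r => (A ^ n) r := by
  simp [opEval, Finsupp.lsum_apply]

theorem opEval_single (A : Module.End ℂ M) (n : ℕ) (r : M) :
    opEval A (Finsupp.single n r) = (A ^ n) r := by
  simp [opEval_apply]

theorem algebraMap_end_pow_apply (c : ℂ) (n : ℕ) (r : M) :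
    ((algebraMap ℂ (Module.End ℂ M) c) ^ n) r = c ^ n • r := by
  rw [← map_pow, Module.algebraMap_end_apply]

theorem evalAt_apply (c : ℂ) (f : Pol1 M) : evalAt c f = f.sum fun n r => c ^ n • r := by
  simp [evalAt, opEval_apply, algebraMap_end_pow_apply]

theorem evalAt_single (c : ℂ) (n : ℕ) (r : M) :
    evalAt c (Finsupp.single n r) = c ^ n • r := by
  simp [evalAt_apply]

theorem pow_intertwine {A : Module.End ℂ M} {A' : Module.End ℂ N} {g : M →ₗ[ℂ] N}
    (h : ∀ r, g (A r) = A' (g r)) (n : ℕ) (r : M) : g ((A ^ n) r) = (A' ^ n) (g r) := by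
  induction n generalizing r with
  | zero => rfl
  | succ k ih => rw [pow_succ, pow_succ, Module.End.mul_apply, Module.End.mul_apply, ih, h]

theorem map_opEval {A : Module.End ℂ M} {A' : Module.End ℂ N} {g : M →ₗ[ℂ] N}
    (h : ∀ r, g (A r) = A' (g r)) (f : Pol1 M) :
    g (opEval A f) = f.sum fun n r => (A' ^ n) (g r) := by
  rw [opEval_apply, map_finsuppSum]
  simp only [pow_intertwine h]

theorem map_evalAt (g : M →ₗ[ℂ] N) (c : ℂ) (f : Pol1 M) :
    g (evalAt c f) = f.sum fun n r => c ^ n • g r := by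
  rw [evalAt_apply, map_finsuppSum]
  simp only [map_smul]

/-- Multiplication by the variable as a linear map. -/
noncomputable def shiftL : Module.End ℂ (Pol1 M) := Finsupp.lmapDomain M ℂ (· + 1)

theorem shiftL_apply (f : Pol1 M) : shiftL f = shift1 f := rfl

theorem opEval_shiftL (A : Module.End ℂ M) (f : Pol1 M) :
    opEval A (shiftL f) = A (opEval A f) := by
  induction f using Finsupp.induction_linear with
  | zero => simp
  | add f g hf hg => simp only [map_add, hf, hg]
  | single n r =>
    simp [shiftL, opEval_single, Finsupp.mapDomain_single, pow_succ']

theorem evalAt_shift1 (c : ℂ) (f : Pol1 M) : evalAt c (shift1 f) = c • evalAt c f := by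
  rw [← shiftL_apply, evalAt, opEval_shiftL, Module.algebraMap_end_apply]

theorem evalAt_mapRange (g : M →ₗ[ℂ] N) (h : g 0 = 0) (c : ℂ) (f : Pol1 M) :
    evalAt c (Finsupp.mapRange g h f) = g (evalAt c f) := by
  rw [map_evalAt, evalAt_apply, Finsupp.sum_mapRange_index (by simp)]

theorem eq_zero_of_evalAt_eq_zero {f : Pol1 M} (h : ∀ c : ℂ, evalAt c f = 0) : f = 0 := by
  ext n
  rw [Finsupp.zero_apply, ← Module.forall_dual_apply_eq_zero_iff ℂ]
  intro ℓ
  have key : (f.sum fun n r => Polynomial.monomial n (ℓ r)) = 0 := by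
    apply Polynomial.funext
    intro c
    have := congrArg ℓ (h c)
    rw [map_evalAt, map_zero] at this
    rw [Finsupp.sum, Polynomial.eval_finsetSum, Polynomial.eval_zero, ← this, Finsupp.sum]
    refine Finset.sum_congr rfl fun i _ => ?_
    rw [Polynomial.eval_monomial, smul_eq_mul, mul_comm]
  have := congrArg (fun p => p.coeff n) key
  simp only [Finsupp.sum, Polynomial.finsetSum_coeff, Polynomial.coeff_monomial,
    Polynomial.coeff_zero, Finset.sum_ite_eq', Finsupp.mem_support_iff] at this
  by_cases hn : f n = 0
  · simp [hn]
  · simpa [hn] using this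

theorem eq_of_evalAt_eq {f g : Pol1 M} (h : ∀ c : ℂ, evalAt c f = evalAt c g) : f = g := by
  rw [← sub_eq_zero]
  exact eq_zero_of_evalAt_eq_zero fun c => by rw [map_sub, h, sub_self]

/-- Substitution of an operator on `M[λ]` for the variable of a polynomial with coefficients
in `M`. -/
noncomputable def substPol (e : Module.End ℂ (Pol1 M)) (f : Pol1 M) : Pol1 M :=
  f.sum fun n r => (e ^ n) (Finsupp.single 0 r)

theorem opEval_substPol {A A' : Module.End ℂ M} {e : Module.End ℂ (Pol1 M)}
    (h : ∀ f, opEval A (e f) = A' (opEval A f)) (f : Pol1 M) :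
    opEval A (substPol e f) = opEval A' f := by
  rw [substPol, map_finsuppSum, opEval_apply A']
  simp only [pow_intertwine h, opEval_single, pow_zero, Module.End.one_apply]

theorem opEval_ev1 {A A' : Module.End ℂ M} {e : Pol1 M → Pol1 M}
    (h : ∀ f, opEval A (e f) = A' (opEval A f)) (f : Pol1 M) :
    opEval A (ev1 f e) = opEval A' f := by
  have hpow : ∀ (n : ℕ) (z : Pol1 M), opEval A (e^[n] z) = (A' ^ n) (opEval A z) := by
    intro n
    induction n with
    | zero => intro z; rfl
    | succ k ih =>
      intro z
      rw [Function.iterate_succ_apply, ih, h, pow_succ, Module.End.mul_apply]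
  rw [ev1, map_finsuppSum, opEval_apply A']
  simp only [hpow, opEval_single, pow_zero, Module.End.one_apply]

end OperatorEvaluation

section Evaluation3

/-- Evaluation of an element of `R[λ,μ,γ]` at scalars. -/
noncomputable def eval3 (l m g : ℂ) : Pol3 R →ₗ[ℂ] R :=
  evalAt g ∘ₗ evalAt m ∘ₗ evalAt l

variable (l m g : ℂ)

theorem eval3_apply (z : Pol3 R) : eval3 l m g z = evalAt g (evalAt m (evalAt l z)) := rfl

theorem eq_of_eval3_eq {z w : Pol3 R} (h : ∀ l m g : ℂ, eval3 l m g z = eval3 l m g w) :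
    z = w :=
  eq_of_evalAt_eq fun l => eq_of_evalAt_eq fun m => eq_of_evalAt_eq fun g => h l m g

theorem eval3_Xl (z : Pol3 R) : eval3 l m g (Xl z) = l • eval3 l m g z := by
  have : evalAt l (Xl z) = l • evalAt l z := evalAt_shift1 l z
  simp only [eval3_apply, this, map_smul]

theorem eval3_Xm (z : Pol3 R) : eval3 l m g (Xm z) = m • eval3 l m g z := by
  have : evalAt l (Xm z) = shift1 (evalAt l z) := evalAt_mapRange shiftL _ l z
  simp only [eval3_apply, this, evalAt_shift1, map_smul]

theorem eval3_Xg (z : Pol3 R) : eval3 l m g (Xg z) = g • eval3 l m g z := by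
  have h1 : evalAt l (Xg z) = Finsupp.mapRange.linearMap shiftL (evalAt l z) :=
    evalAt_mapRange (Finsupp.mapRange.linearMap shiftL) _ l z
  have h2 : ∀ f : Pol1 (Pol1 R),
      evalAt m (Finsupp.mapRange.linearMap shiftL f) = shift1 (evalAt m f) :=
    fun f => evalAt_mapRange shiftL (map_zero _) m f
  simp only [eval3_apply, h1, h2, evalAt_shift1]

theorem eval3_eLM (z : Pol3 R) : eval3 l m g (eLM z) = (l + m) • eval3 l m g z := by
  rw [eLM, map_add, eval3_Xl, eval3_Xm, add_smul]

variable {l m g}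

theorem eval3_iterate {e : Pol3 R → Pol3 R} {c : ℂ}
    (h : ∀ z, eval3 l m g (e z) = c • eval3 l m g z) (n : ℕ) (z : Pol3 R) :
    eval3 l m g (e^[n] z) = c ^ n • eval3 l m g z := by
  induction n generalizing z with
  | zero => simp
  | succ k ih => rw [Function.iterate_succ_apply, ih, h, smul_smul, pow_succ]

theorem eval3_iota3 (r : R) : eval3 l m g (iota3 r) = r := by
  simp [eval3_apply, iota3, evalAt_single]

theorem eval3_ev {e : Pol3 R → Pol3 R} {c : ℂ}
    (h : ∀ z, eval3 l m g (e z) = c • eval3 l m g z) (f : Pol1 R) :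
    eval3 l m g (ev f e) = evalAt c f := by
  rw [ev, map_finsuppSum, evalAt_apply]
  simp only [eval3_iterate h, eval3_iota3]

theorem eval3_lift3 {F : R → Pol3 R} (G : R →ₗ[ℂ] R) (h : ∀ r, eval3 l m g (F r) = G r)
    (w : Pol3 R) : eval3 l m g (lift3 F w) = G (eval3 l m g w) := by
  simp only [lift3, map_finsuppSum, eval3_iterate (eval3_Xl l m g),
    eval3_iterate (eval3_Xm l m g), eval3_iterate (eval3_Xg l m g), h]
  rw [eval3_apply, evalAt_apply l w]
  simp only [map_finsuppSum, map_smul]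
  simp only [evalAt_apply m, map_finsuppSum, map_smul]
  simp only [evalAt_apply g, map_finsuppSum, map_smul, Finsupp.smul_sum]

end Evaluation3

section Pointwise

variable {D : R →ₗ[ℂ] R} {B φ : R → R → Pol1 R}

/-- The value at the scalar `c` of a conformal bilinear map, as a bilinear map. -/
noncomputable def IsConfBilinear.at (h : IsConfBilinear D φ) (c : ℂ) : R →ₗ[ℂ] R →ₗ[ℂ] R :=
  LinearMap.mk₂ ℂ (fun x y => evalAt c (φ x y))
    (fun x x' y => by rw [h.add_left, map_add])
    (fun a x y => by rw [h.smul_left, map_smul])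
    (fun x y y' => by rw [h.add_right, map_add])
    (fun a x y => by rw [h.smul_right, map_smul])

theorem IsConfBilinear.at_apply (h : IsConfBilinear D φ) (c : ℂ) (x y : R) :
    h.at c x y = evalAt c (φ x y) := rfl

theorem IsConfBilinear.at_d_left (h : IsConfBilinear D φ) (c : ℂ) (x y : R) :
    h.at c (D x) y = -(c • h.at c x y) := by
  rw [h.at_apply, h.d_left, map_neg, evalAt_shift1, h.at_apply]

theorem evalAt_D1 (c : ℂ) (f : Pol1 R) : evalAt c (D1 D f) = D (evalAt c f) :=
  evalAt_mapRange D _ c f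

theorem IsConfBilinear.at_d_right (h : IsConfBilinear D φ) (c : ℂ) (x y : R) :
    h.at c x (D y) = D (h.at c x y) + c • h.at c x y := by
  rw [h.at_apply, h.d_right, map_add, evalAt_shift1, evalAt_D1, h.at_apply]

/-- The operator `-∂-c` on `R`. -/
noncomputable def negSub (D : R →ₗ[ℂ] R) (c : ℂ) : Module.End ℂ R :=
  -D - algebraMap ℂ (Module.End ℂ R) c

theorem negSub_apply (c : ℂ) (r : R) : negSub D c r = -(D r) - c • r := rfl

theorem IsSkew.evalAt_eq (h : IsSkew D φ) (c : ℂ) (x y : R) :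
    evalAt c (φ x y) = -opEval (negSub D c) (φ y x) := by
  rw [h x y, map_neg, evalAt, opEval_ev1 (A' := negSub D c)]
  intro f
  change evalAt c (subNeg D f) = negSub D c (evalAt c f)
  rw [subNeg, map_sub, map_neg, evalAt_D1, evalAt_shift1, negSub_apply]

theorem IsConfBilinear.at_opEval_left (h : IsConfBilinear D φ) (c d : ℂ) (f : Pol1 R) (z : R) :
    h.at (c + d) (opEval (negSub D c) f) z = h.at (c + d) (evalAt d f) z := by
  have h1 := map_opEval (A := negSub D c) (A' := algebraMap ℂ (Module.End ℂ R) d)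
    (g := (h.at (c + d)).flip z) (fun r => by
      rw [LinearMap.flip_apply, LinearMap.flip_apply, negSub_apply, map_sub, map_neg, map_smul,
        LinearMap.sub_apply, LinearMap.neg_apply, LinearMap.smul_apply, h.at_d_left,
        Module.algebraMap_end_apply]
      module) f
  have h2 := map_evalAt ((h.at (c + d)).flip z) d f
  simp only [algebraMap_end_pow_apply] at h1
  exact h1.trans h2.symm

/-- Skew-symmetry inside the left argument of a conformal bilinear map. -/
theorem IsConfBilinear.at_skew_left (hB : IsConfBilinear D B) (hφ : IsConfBilinear D φ)
    (hs : IsSkew D φ) (l m : ℂ) (x y z : R) :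
    hB.at (l + m) (hφ.at l x y) z = -hB.at (l + m) (hφ.at m y x) z := by
  rw [hφ.at_apply, hφ.at_apply, hs.evalAt_eq, map_neg, LinearMap.neg_apply, hB.at_opEval_left]

theorem IsConfBilinear.at_opEval_right (h : IsConfBilinear D φ) (c d : ℂ) (f : Pol1 R) (x : R) :
    h.at c x (opEval (negSub D d) f) =
      f.sum fun n r => (negSub D (c + d) ^ n) (h.at c x r) :=
  map_opEval (fun r => by
    rw [negSub_apply, negSub_apply, map_sub, map_neg, map_smul, h.at_d_right]
    module) f

theorem IsLieConformal.at_jacobi (hR : IsLieConformal D B) (l m : ℂ) (x y z : R) :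
    hR.bilin.at l x (hR.bilin.at m y z) =
      hR.bilin.at (l + m) (hR.bilin.at l x y) z + hR.bilin.at m y (hR.bilin.at l x z) := by
  have h := congrArg (eval3 l m 0) (hR.jacobi x y z)
  rwa [map_add, eval3_lift3 (hR.bilin.at l x) (fun r => eval3_ev (eval3_Xl l m 0) _),
    eval3_lift3 ((hR.bilin.at (l + m)).flip z) (fun r => eval3_ev (eval3_eLM l m 0) _),
    eval3_lift3 (hR.bilin.at m y) (fun r => eval3_ev (eval3_Xm l m 0) _),
    eval3_ev (eval3_Xm l m 0), eval3_ev (eval3_Xl l m 0), eval3_ev (eval3_Xl l m 0)] at h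

theorem IsConfBiderivation.at_leibniz (hφ : IsConfBiderivation D B φ)
    (hB : IsConfBilinear D B) (l m : ℂ) (x y z : R) :
    hφ.bilin.at l x (hB.at m y z) =
      hB.at (l + m) (hφ.bilin.at l x y) z + hB.at m y (hφ.bilin.at l x z) := by
  have h := congrArg (eval3 l m 0) (hφ.leibniz x y z)
  rwa [map_add, eval3_lift3 (hφ.bilin.at l x) (fun r => eval3_ev (eval3_Xl l m 0) _),
    eval3_lift3 ((hB.at (l + m)).flip z) (fun r => eval3_ev (eval3_eLM l m 0) _),
    eval3_lift3 (hB.at m y) (fun r => eval3_ev (eval3_Xm l m 0) _),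
    eval3_ev (eval3_Xm l m 0), eval3_ev (eval3_Xl l m 0), eval3_ev (eval3_Xl l m 0)] at h

/-- The Leibniz rule as an identity of polynomials in the variable of `φ`. -/
theorem IsConfBiderivation.leibniz_pol (hφ : IsConfBiderivation D B φ)
    (hB : IsConfBilinear D B) (m : ℂ) (x y z : R) :
    φ x (hB.at m y z) =
      ((φ x y).sum fun n r =>
        (shiftL ^ n) (substPol (shiftL + algebraMap ℂ (Module.End ℂ (Pol1 R)) m) (B r z)))
      + Finsupp.mapRange (hB.at m y) (map_zero _) (φ x z) := by
  refine eq_of_evalAt_eq fun c => ?_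
  have hshift : ∀ f : Pol1 R, evalAt c (shiftL f) = algebraMap ℂ (Module.End ℂ R) c (evalAt c f) :=
    opEval_shiftL _
  have hsub : ∀ f : Pol1 R,
      evalAt c (substPol (shiftL + algebraMap ℂ (Module.End ℂ (Pol1 R)) m) f)
        = evalAt (c + m) f := fun f =>
    opEval_substPol (fun f => by
      simp only [LinearMap.add_apply, map_add, opEval_shiftL, Module.algebraMap_end_apply,
        map_smul]) f
  rw [map_add, map_finsuppSum, evalAt_mapRange]
  simp only [pow_intertwine hshift, algebraMap_end_pow_apply, hsub]
  have h1 := map_evalAt ((hB.at (c + m)).flip z) c (φ x y)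
  exact (hφ.at_leibniz hB c m x y z).trans (congrArg (· + _) h1)

/-- A conformal biderivation is a derivation in its left argument. -/
theorem IsConfBiderivation.at_leibniz_left (hφ : IsConfBiderivation D B φ)
    (hB : IsConfBilinear D B) (hs : IsSkew D B) (l g : ℂ) (x u w : R) :
    hφ.bilin.at (l + g) (hB.at l x u) w =
      hB.at l x (hφ.bilin.at g u w) - hB.at g u (hφ.bilin.at l x w) := by
  have hsub : ∀ f : Pol1 R, opEval (negSub D (l + g))
      (substPol (shiftL + algebraMap ℂ (Module.End ℂ (Pol1 R)) l) f)
        = opEval (negSub D g) f := fun f =>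
    opEval_substPol (fun f => by
      rw [LinearMap.add_apply, map_add, opEval_shiftL, Module.algebraMap_end_apply,
        map_smul, negSub_apply, negSub_apply]
      module) f
  have hB' : ∀ r, opEval (negSub D g) (B r u) = -hB.at g u r := fun r => by
    rw [hB.at_apply, hs.evalAt_eq, neg_neg]
  rw [hφ.bilin.at_apply, hφ.skew.evalAt_eq, hφ.leibniz_pol hB, map_add, map_finsuppSum]
  simp only [pow_intertwine (opEval_shiftL _), hsub, hB', map_neg]
  rw [opEval_apply _ (Finsupp.mapRange _ _ _), Finsupp.sum_mapRange_index (by simp),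
    ← hB.at_opEval_right, hφ.bilin.at_apply, hφ.bilin.at_apply, hφ.skew.evalAt_eq,
    hφ.skew.evalAt_eq l, map_neg, map_neg, hB.at_opEval_right g l, Finsupp.sum_neg, add_comm g l]
  abel

/-- The identity `[φ_λ(x,y)_{λ+μ} [u_γ v]] = [[x_λ y]_{λ+μ} φ_γ(u,v)]`. -/
theorem IsConfBiderivation.at_bracket_comm (hR : IsLieConformal D B)
    (hφ : IsConfBiderivation D B φ) (l m g : ℂ) (x y u v : R) :
    hR.bilin.at (l + m) (hφ.bilin.at l x y) (hR.bilin.at g u v) =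
      hR.bilin.at (l + m) (hR.bilin.at l x y) (hφ.bilin.at g u v) := by
  let H (l m g : ℂ) (x y u : R) : R :=
    hR.bilin.at (l + m) (hφ.bilin.at l x y) (hR.bilin.at g u v) -
      hR.bilin.at (l + m) (hR.bilin.at l x y) (hφ.bilin.at g u v)
  have swap12 : ∀ l m g x y u, H l m g x y u = -H m l g y x u := by
    intro l m g x y u
    simp only [H]
    rw [hR.bilin.at_skew_left hφ.bilin hφ.skew, hR.bilin.at_skew_left hR.bilin hR.skew,
      add_comm m l]
    abel
  have swap13 : ∀ l m g x y u, H l m g x y u = H g m l u y x := by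
    intro l m g x y u
    have e := hφ.at_leibniz hR.bilin (l + g) m (hR.bilin.at l x u) y v
    simp only [hφ.at_leibniz_left hR.bilin hR.skew, map_sub, LinearMap.sub_apply] at e
    simp only [hφ.at_leibniz hR.bilin, map_add] at e
    have j1 := hR.at_jacobi l (g + m) x (hφ.bilin.at g u y) v
    have j2 := hR.at_jacobi g (l + m) u (hφ.bilin.at l x y) v
    have j3 := hR.at_jacobi l m x y (hφ.bilin.at g u v)
    have j4 := hR.at_jacobi g m u y (hφ.bilin.at l x v)
    rw [← add_assoc] at j1
    rw [← add_assoc, add_comm g l] at j2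
    simp only [H]
    linear_combination (norm := module) j1 + j3 - j2 - j4 - e
  have hneg : H l m g x y u = -H l m g x y u := by
    conv_lhs => rw [swap12, swap13 m, swap12 g, swap13 l, neg_neg, swap12 m, swap13 g]
  have htwo : (2 : ℂ) • H l m g x y u = 0 := by
    rw [two_smul, ← eq_neg_iff_add_eq_zero]
    exact hneg
  exact sub_eq_zero.mp ((smul_eq_zero.mp htwo).resolve_left two_ne_zero)

end Pointwise

/-- if `φ` is a conformal biderivation and `[x_λ y] = 0`, then `φ_λ(x,y)`
centralizes all λ-brackets: `[(φ_λ(x,y))_{λ+μ} [u_μ v]] = 0` for all `u, v ∈ R`. -/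
theorem biderivation_centralizer {R : Type} [AddCommGroup R] [Module ℂ R]
    (D : R →ₗ[ℂ] R) (B : R → R → Pol1 R) (hR : IsLieConformal D B)
    (φ : R → R → Pol1 R) (hφ : IsConfBiderivation D B φ)
    (x y : R) (hxy : B x y = 0) :
    ∀ u v : R,
      lift3 (fun r => lift3 (fun s => ev (B r s) eLM) (ev (B u v) Xm))
        (ev (φ x y) Xl) = 0 := by
  intro u v
  refine eq_of_eval3_eq fun l m g => ?_
  rw [eval3_lift3 ((hR.bilin.at (l + m)).flip (hR.bilin.at m u v)), eval3_ev (eval3_Xl l m g),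
    map_zero, LinearMap.flip_apply, ← hφ.bilin.at_apply, hφ.at_bracket_comm hR,
    hR.bilin.at_apply l, hxy, map_zero, map_zero, LinearMap.zero_apply]
  intro r
  rw [eval3_lift3 (hR.bilin.at (l + m) r) (fun s => eval3_ev (eval3_eLM l m g) _),
    eval3_ev (eval3_Xm l m g)]
  rfl

end ConfBider
end

section
/- For fixed a, b ∈ C, the free C[∂]-module CLW(a,b) = (⊕_{i∈Z} C[∂]L_i) ⊕ (⊕_{i∈Z} C[∂]G_i), with λ-brackets [L_i λ L_j] = (∂+2λ)L_{i+j}, [L_i λ G_j] = (∂+(1-b)λ)G_{i+j}, [G_i λ L_j] = -(b∂+(b-1)λ)G_{i+j}, [G_i λ G_j] = 0, extended by conformal sesquilinearity, is a Lie conformal algebra (it satisfies skew-symmetry and the Jacobi identity). -/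
/- Framework: a Lie conformal algebra over ℂ is a ℂ[∂]-module `R` (given by a ℂ-module
with a ℂ-linear operator `D` for the action of `∂`) with a λ-bracket `B : R → R → R[λ]`.
We model `R[λ]` as `ℕ →₀ R` (coefficient of `λ^n` at index `n`) and `R[λ,μ,γ]` as an
iterated Finsupp.  Substitutions of the bracket variable are implemented by evaluating
the polynomial at a commuting operator (e.g. multiplication by `λ`, by `λ+μ`, or by
`-∂-λ`), and brackets/biderivations are extended to polynomial-valued arguments by
ℂ[λ,μ,γ]-bilinearity. -/

namespace ConfBider

variable {R : Type} [AddCommGroup R] [Module ℂ R]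

/-- Coefficient finsupp of a polynomial. -/
noncomputable def toF {S : Type} [Semiring S] (p : Polynomial S) : ℕ →₀ S :=
  Finsupp.onFinset p.support (fun n => p.coeff n) (fun n h => Polynomial.mem_support_iff.mpr h)

/-- The loop `W(a,b)` conformal algebra
`CLW(a,b) = (⊕_{i∈ℤ} ℂ[∂]L_i) ⊕ (⊕_{i∈ℤ} ℂ[∂]G_i)` as a free `ℂ[∂]`-module; the basis
element indexed by `(false, i)` is `L_i` and the one indexed by `(true, i)` is `G_i`. -/
abbrev WR : Type := (Bool × ℤ) →₀ Polynomial ℂ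

/-- The action of `∂` on `CLW(a,b)`. -/
noncomputable def DW : WR →ₗ[ℂ] WR :=
  Finsupp.mapRange.linearMap (LinearMap.mulLeft ℂ (Polynomial.X : Polynomial ℂ))

/-- The basis element `L i`. -/
noncomputable def Lw (i : ℤ) : WR := Finsupp.single (false, i) (1 : Polynomial ℂ)

/-- The basis element `G i`. -/
noncomputable def Gw (i : ℤ) : WR := Finsupp.single (true, i) (1 : Polynomial ℂ)

/-- `ℂ → ℂ[∂][λ]` (constants). -/
noncomputable def cc : ℂ →+* Polynomial (Polynomial ℂ) := Polynomial.C.comp Polynomial.C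

/-- `∂` inside `ℂ[∂][λ]`. -/
noncomputable def vpd : Polynomial (Polynomial ℂ) := Polynomial.C Polynomial.X

/-- `λ` inside `ℂ[∂][λ]`. -/
noncomputable def vpl : Polynomial (Polynomial ℂ) := Polynomial.X

/-- The polynomial factor in the bracket of two basis elements:
`(∂+2λ)` for `[L,L]`, `(∂+(1-b)λ)` for `[L,G]`, `-(b∂+(b-1)λ)` for `[G,L]`,
and `0` for `[G,G]`. -/
noncomputable def wFactor (b : ℂ) : Bool → Bool → Polynomial (Polynomial ℂ)
  | false, false => vpd + 2 * vpl
  | false, true => vpd + cc (1 - b) * vpl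
  | true, false => -(cc b * vpd + cc (b - 1) * vpl)
  | true, true => 0

/-- The λ-bracket of `CLW(a,b)` (it depends only on `b`), determined by
`[L_i λ L_j] = (∂+2λ)L_{i+j}`, `[L_i λ G_j] = (∂+(1-b)λ)G_{i+j}`,
`[G_i λ L_j] = -(b∂+(b-1)λ)G_{i+j}`, `[G_i λ G_j] = 0`, and conformal sesquilinearity. -/
noncomputable def BW (b : ℂ) (f g : WR) : Pol1 WR :=
  f.sum fun s p => g.sum fun t q =>
    Finsupp.mapRange (fun c => Finsupp.single (s.1 || t.1, s.2 + t.2) c)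
      (Finsupp.single_zero _)
      (toF ((p.eval₂ cc (-vpl)) * (q.eval₂ cc (vpd + vpl)) * wFactor b s.1 t.1))

/-- The element `Σ_k a_{k-i-j} L_k` (if `s = false`) resp. `Σ_k a_{k-i-j} G_k`
(if `s = true`). -/
noncomputable def Sw (s : Bool) (a : ℤ →₀ ℂ) (i j : ℤ) : WR :=
  a.sum fun m c => Finsupp.single (s, m + i + j) (Polynomial.C c)

/-- `(∂+cλ)·x ∈ CLW(a,b)[λ]`. -/
noncomputable def dcl (c : ℂ) (x : WR) : Pol1 WR :=
  Finsupp.single 0 (DW x) + Finsupp.single 1 (c • x)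

section Operators

set_option maxSynthPendingDepth 6

/-- `shift1` as a linear map. -/
noncomputable def shift1L : Module.End ℂ (Pol1 R) := Finsupp.lmapDomain R ℂ (· + 1)

/-- `D1 D` as a linear map. -/
noncomputable def D1L (D : R →ₗ[ℂ] R) : Module.End ℂ (Pol1 R) := Finsupp.mapRange.linearMap D

/-- `subNeg D` as a linear map. -/
noncomputable def subNegL (D : R →ₗ[ℂ] R) : Module.End ℂ (Pol1 R) := -D1L D - shift1L

/-- `Xl` as a linear map. -/
noncomputable def XlL : Module.End ℂ (Pol3 R) := Finsupp.lmapDomain _ ℂ (· + 1)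

/-- `Xm` as a linear map. -/
noncomputable def XmL : Module.End ℂ (Pol3 R) :=
  Finsupp.mapRange.linearMap (Finsupp.lmapDomain _ ℂ (· + 1))

/-- `Xg` as a linear map. -/
noncomputable def XgL : Module.End ℂ (Pol3 R) :=
  Finsupp.mapRange.linearMap (Finsupp.mapRange.linearMap (Finsupp.lmapDomain _ ℂ (· + 1)))

/-- The action of `∂` on the coefficients of `R[λ,μ,γ]`. -/
noncomputable def D3L (D : R →ₗ[ℂ] R) : Module.End ℂ (Pol3 R) :=
  Finsupp.mapRange.linearMap (Finsupp.mapRange.linearMap (Finsupp.mapRange.linearMap D))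

/-- `iota3` as a linear map. -/
noncomputable def iota3L : R →ₗ[ℂ] Pol3 R :=
  Finsupp.lsingle 0 ∘ₗ Finsupp.lsingle 0 ∘ₗ Finsupp.lsingle 0

/-- `ev1 · E` as a linear map. -/
noncomputable def ev1L (E : Module.End ℂ (Pol1 R)) : Pol1 R →ₗ[ℂ] Pol1 R :=
  Finsupp.lsum ℂ fun n => (E ^ n) ∘ₗ Finsupp.lsingle 0

/-- `ev · E` as a linear map. -/
noncomputable def evL (E : Module.End ℂ (Pol3 R)) : Pol1 R →ₗ[ℂ] Pol3 R :=
  Finsupp.lsum ℂ fun n => (E ^ n) ∘ₗ iota3L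

/-- `lift3 F` as a linear map. -/
noncomputable def lift3L (F : R →ₗ[ℂ] Pol3 R) : Module.End ℂ (Pol3 R) :=
  Finsupp.lsum ℂ fun a => Finsupp.lsum ℂ fun b => Finsupp.lsum ℂ fun c =>
    (XlL ^ a * XmL ^ b * XgL ^ c) ∘ₗ F

theorem ev1_eq_ev1L (f : Pol1 R) (E : Module.End ℂ (Pol1 R)) : ev1 f E = ev1L E f := by
  simp only [ev1, ev1L, Finsupp.coe_lsum, LinearMap.comp_apply, Module.End.coe_pow, Finsupp.sum,
    Finsupp.lsingle_apply]

theorem ev_eq_evL (f : Pol1 R) (E : Module.End ℂ (Pol3 R)) : ev f E = evL E f := by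
  simp only [ev, evL, Finsupp.coe_lsum, LinearMap.comp_apply, Module.End.coe_pow, Finsupp.sum,
    iota3, iota3L, Finsupp.lsingle_apply]

theorem lift3_eq_lift3L (F : R →ₗ[ℂ] Pol3 R) (w : Pol3 R) : lift3 F w = lift3L F w := by
  simp only [lift3, lift3L, Finsupp.coe_lsum, Finsupp.sum, LinearMap.comp_apply,
    Module.End.mul_apply, Module.End.coe_pow]
  rfl

theorem XmL_XlL (z : Pol3 R) : XmL (XlL z) = XlL (XmL z) := by
  refine LinearMap.congr_fun (f := XmL ∘ₗ XlL) (g := XlL ∘ₗ XmL) ?_ z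
  ext : 6
  simp [XlL, XmL]

theorem XgL_XlL (z : Pol3 R) : XgL (XlL z) = XlL (XgL z) := by
  refine LinearMap.congr_fun (f := XgL ∘ₗ XlL) (g := XlL ∘ₗ XgL) ?_ z
  ext : 6
  simp [XlL, XgL]

theorem XgL_XmL (z : Pol3 R) : XgL (XmL z) = XmL (XgL z) := by
  refine LinearMap.congr_fun (f := XgL ∘ₗ XmL) (g := XmL ∘ₗ XgL) ?_ z
  ext : 6
  simp [XmL, XgL]

theorem D3L_XlL (D : R →ₗ[ℂ] R) (z : Pol3 R) : D3L D (XlL z) = XlL (D3L D z) := by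
  refine LinearMap.congr_fun (f := D3L D ∘ₗ XlL) (g := XlL ∘ₗ D3L D) ?_ z
  ext : 6
  simp [XlL, D3L]

theorem D3L_XmL (D : R →ₗ[ℂ] R) (z : Pol3 R) : D3L D (XmL z) = XmL (D3L D z) := by
  refine LinearMap.congr_fun (f := D3L D ∘ₗ XmL) (g := XmL ∘ₗ D3L D) ?_ z
  ext : 6
  simp [XmL, D3L]

theorem D3L_XgL (D : R →ₗ[ℂ] R) (z : Pol3 R) : D3L D (XgL z) = XgL (D3L D z) := by
  refine LinearMap.congr_fun (f := D3L D ∘ₗ XgL) (g := XgL ∘ₗ D3L D) ?_ z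
  ext : 6
  simp [XgL, D3L]

theorem D1L_shift1L (D : R →ₗ[ℂ] R) (z : Pol1 R) : D1L D (shift1L z) = shift1L (D1L D z) := by
  refine LinearMap.congr_fun (f := D1L D ∘ₗ shift1L) (g := shift1L ∘ₗ D1L D) ?_ z
  ext : 2
  simp [shift1L, D1L]

theorem commute_XlL_XmL : Commute (XlL : Module.End ℂ (Pol3 R)) XmL :=
  LinearMap.ext fun z => (XmL_XlL z).symm

theorem commute_XlL_XgL : Commute (XlL : Module.End ℂ (Pol3 R)) XgL :=
  LinearMap.ext fun z => (XgL_XlL z).symm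

theorem commute_XmL_XgL : Commute (XmL : Module.End ℂ (Pol3 R)) XgL :=
  LinearMap.ext fun z => (XgL_XmL z).symm

theorem commute_D3L_XlL (D : R →ₗ[ℂ] R) : Commute (D3L D) XlL :=
  LinearMap.ext (D3L_XlL D)

theorem commute_D3L_XmL (D : R →ₗ[ℂ] R) : Commute (D3L D) XmL :=
  LinearMap.ext (D3L_XmL D)

theorem commute_D3L_XgL (D : R →ₗ[ℂ] R) : Commute (D3L D) XgL :=
  LinearMap.ext (D3L_XgL D)

theorem commute_D1L_subNegL (D : R →ₗ[ℂ] R) : Commute (D1L D) (subNegL D) :=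
  ((Commute.refl _).neg_right).sub_right (LinearMap.ext (D1L_shift1L D))

@[simp] theorem D3L_iota3L (D : R →ₗ[ℂ] R) (r : R) : D3L D (iota3L r) = iota3L (D r) := by
  simp [D3L, iota3L]

theorem evL_single (E : Module.End ℂ (Pol3 R)) (n : ℕ) (r : R) :
    evL E (Finsupp.single n r) = (E ^ n) (iota3L r) := by
  simp [evL]

theorem evL_shift1L (E : Module.End ℂ (Pol3 R)) (f : Pol1 R) :
    evL E (shift1L f) = E (evL E f) := by
  refine LinearMap.congr_fun (f := evL E ∘ₗ shift1L) (g := E ∘ₗ evL E) ?_ f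
  refine Finsupp.lhom_ext fun n r => ?_
  simp [shift1L, evL_single, Finsupp.mapDomain_single, pow_succ', Module.End.mul_apply]

theorem evL_D1L (D : R →ₗ[ℂ] R) {E : Module.End ℂ (Pol3 R)} (h : Commute (D3L D) E)
    (f : Pol1 R) : evL E (D1L D f) = D3L D (evL E f) := by
  refine LinearMap.congr_fun (f := evL E ∘ₗ D1L D) (g := D3L D ∘ₗ evL E) ?_ f
  refine Finsupp.lhom_ext fun n r => ?_
  have := LinearMap.congr_fun (h.pow_right n).eq (iota3L r)
  simp only [Module.End.mul_apply] at this
  simp [D1L, evL_single, this]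

theorem ev1L_single (E : Module.End ℂ (Pol1 R)) (n : ℕ) (r : R) :
    ev1L E (Finsupp.single n r) = (E ^ n) (Finsupp.single 0 r) := by
  simp [ev1L]

theorem ev1L_shift1L (E : Module.End ℂ (Pol1 R)) (f : Pol1 R) :
    ev1L E (shift1L f) = E (ev1L E f) := by
  refine LinearMap.congr_fun (f := ev1L E ∘ₗ shift1L) (g := E ∘ₗ ev1L E) ?_ f
  refine Finsupp.lhom_ext fun n r => ?_
  simp [shift1L, ev1L_single, Finsupp.mapDomain_single, pow_succ', Module.End.mul_apply]

theorem ev1L_D1L (D : R →ₗ[ℂ] R) {E : Module.End ℂ (Pol1 R)} (h : Commute (D1L D) E)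
    (f : Pol1 R) : ev1L E (D1L D f) = D1L D (ev1L E f) := by
  refine LinearMap.congr_fun (f := ev1L E ∘ₗ D1L D) (g := D1L D ∘ₗ ev1L E) ?_ f
  refine Finsupp.lhom_ext fun n r => ?_
  have := LinearMap.congr_fun (h.pow_right n).eq (Finsupp.single 0 r)
  simp only [Module.End.mul_apply] at this
  simp only [LinearMap.comp_apply, ev1L_single, this]
  simp [D1L, ev1L_single]

theorem lift3L_single (F : R →ₗ[ℂ] Pol3 R) (a b c : ℕ) (r : R) :
    lift3L F (Finsupp.single a (Finsupp.single b (Finsupp.single c r))) =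
      (XlL ^ a * XmL ^ b * XgL ^ c : Module.End ℂ (Pol3 R)) (F r) := by
  simp only [lift3L, Finsupp.lsum_single, LinearMap.comp_apply]

@[simp] theorem lift3L_iota3L (F : R →ₗ[ℂ] Pol3 R) (r : R) : lift3L F (iota3L r) = F r := by
  simp [iota3L, lift3L_single]

/-- Linear maps on `R[λ,μ,γ]` agreeing on monomials are equal. -/
theorem pol3_hom_ext {M : Type*} [AddCommGroup M] [Module ℂ M] {f g : Pol3 R →ₗ[ℂ] M}
    (h : ∀ a b c r, f (Finsupp.single a (Finsupp.single b (Finsupp.single c r))) =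
      g (Finsupp.single a (Finsupp.single b (Finsupp.single c r)))) : f = g := by
  ext : 6
  exact h _ _ _ _

theorem lift3L_XlL (F : R →ₗ[ℂ] Pol3 R) (w : Pol3 R) :
    lift3L F (XlL w) = XlL (lift3L F w) := by
  refine LinearMap.congr_fun (f := lift3L F ∘ₗ XlL) (g := XlL ∘ₗ lift3L F) ?_ w
  refine pol3_hom_ext fun a b c r => ?_
  simp only [LinearMap.comp_apply, lift3L_single]
  rw [XlL, Finsupp.lmapDomain_apply, Finsupp.mapDomain_single, ← XlL, lift3L_single, pow_succ']
  simp only [mul_assoc, Module.End.mul_apply]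

theorem lift3L_XmL (F : R →ₗ[ℂ] Pol3 R) (w : Pol3 R) :
    lift3L F (XmL w) = XmL (lift3L F w) := by
  refine LinearMap.congr_fun (f := lift3L F ∘ₗ XmL) (g := XmL ∘ₗ lift3L F) ?_ w
  refine pol3_hom_ext fun a b c r => ?_
  have h : (XmL : Module.End ℂ (Pol3 R)) (Finsupp.single a (Finsupp.single b (Finsupp.single c r)))
      = Finsupp.single a (Finsupp.single (b + 1) (Finsupp.single c r)) := by
    simp [XmL]
  have e : (XlL ^ a * XmL ^ (b + 1) * XgL ^ c : Module.End ℂ (Pol3 R)) =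
      XmL * (XlL ^ a * XmL ^ b * XgL ^ c) := by
    rw [pow_succ', ← mul_assoc, (commute_XlL_XmL.pow_left a).eq]
    simp only [mul_assoc]
  simp only [LinearMap.comp_apply, h, lift3L_single, e, Module.End.mul_apply]

theorem lift3L_D3L (D : R →ₗ[ℂ] R) (F : R →ₗ[ℂ] Pol3 R) (w : Pol3 R) :
    lift3L F (D3L D w) = lift3L (F ∘ₗ D) w := by
  refine LinearMap.congr_fun (f := lift3L F ∘ₗ D3L D) (g := lift3L (F ∘ₗ D)) ?_ w
  refine pol3_hom_ext fun a b c r => ?_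
  simp [D3L, lift3L_single]

theorem lift3L_comp_left {E : Module.End ℂ (Pol3 R)} (hl : Commute E XlL) (hm : Commute E XmL)
    (hg : Commute E XgL) (F : R →ₗ[ℂ] Pol3 R) (w : Pol3 R) :
    lift3L (E ∘ₗ F) w = E (lift3L F w) := by
  refine LinearMap.congr_fun (f := lift3L (E ∘ₗ F)) (g := E ∘ₗ lift3L F) ?_ w
  refine pol3_hom_ext fun a b c r => ?_
  have := (((hl.pow_right a).mul_right (hm.pow_right b)).mul_right (hg.pow_right c)).eq
  simpa [lift3L_single, Module.End.mul_apply] using (LinearMap.congr_fun this (F r)).symm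

theorem lift3L_add (F G : R →ₗ[ℂ] Pol3 R) (w : Pol3 R) :
    lift3L (F + G) w = lift3L F w + lift3L G w := by
  refine LinearMap.congr_fun (f := lift3L (F + G)) (g := lift3L F + lift3L G) ?_ w
  refine pol3_hom_ext fun a b c r => ?_
  simp [lift3L_single]

theorem lift3L_smul (k : ℂ) (F : R →ₗ[ℂ] Pol3 R) (w : Pol3 R) :
    lift3L (k • F) w = k • lift3L F w := by
  refine LinearMap.congr_fun (f := lift3L (k • F)) (g := k • lift3L F) ?_ w
  refine pol3_hom_ext fun a b c r => ?_
  simp [lift3L_single]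

theorem lift3L_neg (F : R →ₗ[ℂ] Pol3 R) (w : Pol3 R) : lift3L (-F) w = -lift3L F w := by
  simpa using lift3L_smul (-1) F w

end Operators

section Generators

set_option maxSynthPendingDepth 6

variable {D : R →ₗ[ℂ] R} {φ : R → R → Pol1 R}

/-- A conformal bilinear map as a bilinear map. -/
noncomputable def IsConfBilinear.toLinear (h : IsConfBilinear D φ) : R →ₗ[ℂ] R →ₗ[ℂ] Pol1 R :=
  LinearMap.mk₂ ℂ φ h.add_left h.smul_left h.add_right h.smul_right

/-- The Jacobi identity for a fixed triple, in terms of linear maps. -/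
def JacobiAt (B : R →ₗ[ℂ] R →ₗ[ℂ] Pol1 R) (x y z : R) : Prop :=
  lift3L (evL XlL ∘ₗ B x) (evL XmL (B y z)) =
    lift3L (evL (XlL + XmL) ∘ₗ B.flip z) (evL XlL (B x y)) +
      lift3L (evL XmL ∘ₗ B y) (evL XlL (B x z))

/-- `S` generates `R` as a `ℂ[∂]`-module, phrased as an induction principle. -/
def Generates (D : R →ₗ[ℂ] R) (S : Set R) : Prop :=
  ∀ P : R → Prop, (∀ x ∈ S, P x) → (∀ x y, P x → P y → P (x + y)) →
    (∀ (c : ℂ) x, P x → P (c • x)) → (∀ x, P x → P (D x)) → ∀ x, P x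

section

variable {B : R →ₗ[ℂ] R →ₗ[ℂ] Pol1 R}

theorem JacobiAt.D_left (hl : ∀ x y, B (D x) y = -shift1L (B x y)) {x y z : R}
    (h : JacobiAt B x y z) : JacobiAt B (D x) y z := by
  have e : evL XlL ∘ₗ B (D x) = -(XlL ∘ₗ (evL XlL ∘ₗ B x)) := by
    ext1 r
    simp [hl, evL_shift1L]
  unfold JacobiAt at h ⊢
  rw [e, lift3L_neg, lift3L_comp_left (Commute.refl _) commute_XlL_XmL commute_XlL_XgL]
  simp only [hl, map_neg, evL_shift1L, lift3L_XlL, h, map_add, neg_add]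

theorem lift3L_evL_D_left (hl : ∀ x y, B (D x) y = -shift1L (B x y)) (z : R) (w : Pol3 R) :
    lift3L (evL (XlL + XmL) ∘ₗ B.flip z) (D3L D w) =
      -(XlL (lift3L (evL (XlL + XmL) ∘ₗ B.flip z) w) +
        XmL (lift3L (evL (XlL + XmL) ∘ₗ B.flip z) w)) := by
  have e : (evL (XlL + XmL) ∘ₗ B.flip z) ∘ₗ D =
      -((XlL + XmL) ∘ₗ (evL (XlL + XmL) ∘ₗ B.flip z)) := by
    ext1 r
    simp only [LinearMap.comp_apply, LinearMap.flip_apply, hl, map_neg, evL_shift1L,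
      LinearMap.neg_apply]
  rw [lift3L_D3L, e, lift3L_neg, lift3L_comp_left ((Commute.refl _).add_left commute_XlL_XmL.symm)
    (commute_XlL_XmL.add_left (Commute.refl _)) (commute_XlL_XgL.add_left commute_XmL_XgL),
    LinearMap.add_apply]

theorem JacobiAt.D_mid (hl : ∀ x y, B (D x) y = -shift1L (B x y))
    (hr : ∀ x y, B x (D y) = D1L D (B x y) + shift1L (B x y)) {x y z : R}
    (h : JacobiAt B x y z) : JacobiAt B x (D y) z := by
  have e : evL XmL ∘ₗ B (D y) = -(XmL ∘ₗ (evL XmL ∘ₗ B y)) := by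
    ext1 r
    simp [hl, evL_shift1L]
  unfold JacobiAt at h ⊢
  rw [e, lift3L_neg, lift3L_comp_left commute_XlL_XmL.symm (Commute.refl _) commute_XmL_XgL, hr, hl, map_add, map_add, evL_D1L D (commute_D3L_XlL D),
    lift3L_evL_D_left hl]
  simp only [map_neg, evL_shift1L, lift3L_XlL, lift3L_XmL, h, map_add]
  abel

theorem lift3L_evL_D_right (hr : ∀ x y, B x (D y) = D1L D (B x y) + shift1L (B x y)) (x : R)
    {E : Module.End ℂ (Pol3 R)} (hD : Commute (D3L D) E) (hl : Commute E XlL)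
    (hm : Commute E XmL) (hg : Commute E XgL) (w : Pol3 R) :
    lift3L (evL E ∘ₗ B x) (D3L D w) =
      D3L D (lift3L (evL E ∘ₗ B x) w) + E (lift3L (evL E ∘ₗ B x) w) := by
  have e : (evL E ∘ₗ B x) ∘ₗ D = (D3L D + E) ∘ₗ (evL E ∘ₗ B x) := by
    ext1 r
    simp only [LinearMap.comp_apply, hr, map_add, evL_shift1L, evL_D1L D hD, LinearMap.add_apply]
  rw [lift3L_D3L, e, lift3L_comp_left ((commute_D3L_XlL D).add_left hl)
    ((commute_D3L_XmL D).add_left hm) ((commute_D3L_XgL D).add_left hg), LinearMap.add_apply]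

theorem JacobiAt.D_right (hr : ∀ x y, B x (D y) = D1L D (B x y) + shift1L (B x y)) {x y z : R}
    (h : JacobiAt B x y z) : JacobiAt B x y (D z) := by
  have hD : Commute (D3L D) (XlL + XmL) := (commute_D3L_XlL D).add_right (commute_D3L_XmL D)
  have e : evL (XlL + XmL) ∘ₗ B.flip (D z) =
      (D3L D + (XlL + XmL)) ∘ₗ (evL (XlL + XmL) ∘ₗ B.flip z) := by
    ext1 r
    simp only [LinearMap.comp_apply, LinearMap.flip_apply, hr, map_add, evL_shift1L, evL_D1L D hD,
      LinearMap.add_apply]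
  unfold JacobiAt at h ⊢
  rw [e, lift3L_comp_left
    ((commute_D3L_XlL D).add_left ((Commute.refl _).add_left commute_XlL_XmL.symm))
    ((commute_D3L_XmL D).add_left (commute_XlL_XmL.add_left (Commute.refl _)))
    ((commute_D3L_XgL D).add_left (commute_XlL_XgL.add_left commute_XmL_XgL)),
    hr, hr, map_add, map_add, map_add, map_add, evL_D1L D (commute_D3L_XlL D),
    evL_D1L D (commute_D3L_XmL D),
    lift3L_evL_D_right hr x (commute_D3L_XlL D) (Commute.refl _) commute_XlL_XmL commute_XlL_XgL,
    lift3L_evL_D_right hr y (commute_D3L_XmL D) commute_XlL_XmL.symm (Commute.refl _)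
      commute_XmL_XgL]
  simp only [LinearMap.add_apply, evL_shift1L, lift3L_XlL, lift3L_XmL, h, map_add]
  abel

/-- The Jacobi identity only has to be checked on generators. -/
theorem JacobiAt.of_generators (hl : ∀ x y, B (D x) y = -shift1L (B x y))
    (hr : ∀ x y, B x (D y) = D1L D (B x y) + shift1L (B x y)) {S : Set R} (hS : Generates D S)
    (h : ∀ x ∈ S, ∀ y ∈ S, ∀ z ∈ S, JacobiAt B x y z) (x y z : R) : JacobiAt B x y z := by
  refine hS (JacobiAt B · y z) (fun x hx => ?_) (fun x x' h h' => ?_) (fun c x h => ?_)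
    (fun x h => h.D_left hl) x
  · refine hS (JacobiAt B x · z) (fun y hy => ?_) (fun y y' h h' => ?_) (fun c y h => ?_)
      (fun y h => h.D_mid hl hr) y
    · refine hS (JacobiAt B x y) (fun z hz => h x hx y hy z hz) (fun z z' h h' => ?_)
        (fun c z h => ?_) (fun z h => h.D_right hr) z
      · unfold JacobiAt at h h' ⊢
        simp only [map_add, LinearMap.comp_add, lift3L_add, h, h']
        abel
      · unfold JacobiAt at h ⊢
        simp only [map_smul, LinearMap.comp_smul, lift3L_smul, h, smul_add]
    · unfold JacobiAt at h h' ⊢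
      simp only [map_add, LinearMap.add_apply, LinearMap.comp_add, lift3L_add, h, h']
      abel
    · unfold JacobiAt at h ⊢
      simp only [map_smul, LinearMap.smul_apply, LinearMap.comp_smul, lift3L_smul, h, smul_add]
  · unfold JacobiAt at h h' ⊢
    simp only [map_add, LinearMap.add_apply, LinearMap.comp_add, lift3L_add, h, h']
    abel
  · unfold JacobiAt at h ⊢
    simp only [map_smul, LinearMap.smul_apply, LinearMap.comp_smul, lift3L_smul, h, smul_add]

/-- Skew-symmetry only has to be checked on generators. -/
theorem skew_of_generators (hl : ∀ x y, B (D x) y = -shift1L (B x y))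
    (hr : ∀ x y, B x (D y) = D1L D (B x y) + shift1L (B x y)) {S : Set R} (hS : Generates D S)
    (h : ∀ x ∈ S, ∀ y ∈ S, B x y = -ev1L (subNegL D) (B y x)) (x y : R) :
    B x y = -ev1L (subNegL D) (B y x) := by
  refine hS (fun x => B x y = -ev1L (subNegL D) (B y x)) (fun x hx => ?_) (fun x x' h h' => ?_)
    (fun c x h => ?_) (fun x h => ?_) x
  · refine hS (fun y => B x y = -ev1L (subNegL D) (B y x)) (fun y hy => h x hx y hy)
      (fun y y' h h' => ?_) (fun c y h => ?_) (fun y h => ?_) y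
    · simp only [map_add, LinearMap.add_apply, h, h', neg_add]
    · simp only [map_smul, LinearMap.smul_apply, h, smul_neg]
    · rw [hl, hr, h]
      simp only [map_neg, ev1L_shift1L]
      simp only [subNegL, LinearMap.sub_apply, LinearMap.neg_apply]
      abel
  · simp only [map_add, LinearMap.add_apply, h, h', neg_add]
  · simp only [map_smul, LinearMap.smul_apply, h, smul_neg]
  · rw [hl, hr, h, map_add, ev1L_shift1L, ev1L_D1L D (commute_D1L_subNegL D)]
    simp only [subNegL, LinearMap.sub_apply, LinearMap.neg_apply, map_neg]
    abel

end

/-- A conformal bilinear map satisfying skew-symmetry and the Jacobi identity on generators is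
the λ-bracket of a Lie conformal algebra. -/
theorem IsConfBilinear.isLieConformal (h : IsConfBilinear D φ) {S : Set R} (hS : Generates D S)
    (skew : ∀ x ∈ S, ∀ y ∈ S,
      h.toLinear x y = -ev1L (subNegL D) (h.toLinear y x))
    (jacobi : ∀ x ∈ S, ∀ y ∈ S, ∀ z ∈ S, JacobiAt h.toLinear x y z) : IsLieConformal D φ where
  bilin := h
  skew x y := by
    have := skew_of_generators (B := h.toLinear) h.d_left h.d_right hS skew x y
    rw [← ev1_eq_ev1L] at this
    exact this
  jacobi x y z := by
    have := JacobiAt.of_generators (B := h.toLinear) h.d_left h.d_right hS jacobi x y z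
    unfold JacobiAt at this
    simp only [← lift3_eq_lift3L, ← ev_eq_evL] at this
    have e (E : Module.End ℂ (Pol3 R)) (u : R) :
        (fun r => ev (φ u r) E) = evL E ∘ₗ h.toLinear u := by
      funext r
      exact ev_eq_evL _ E
    have e' (E : Module.End ℂ (Pol3 R)) (u : R) :
        (fun r => ev (φ r u) E) = evL E ∘ₗ h.toLinear.flip u := by
      funext r
      exact ev_eq_evL _ E
    have e₁ := e XlL x
    have e₂ := e XmL y
    have e₃ := e' (XlL + XmL) z
    rw [← e₁, ← e₂, ← e₃] at this
    exact this

end Generators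

section LoopW

set_option maxSynthPendingDepth 6

/-- `p(∂,λ) u` as an element of `CLW(a,b)[λ]`. -/
noncomputable def embed (u : Bool × ℤ) (p : Polynomial (Polynomial ℂ)) : Pol1 WR :=
  Finsupp.mapRange (fun c => Finsupp.single u c) (Finsupp.single_zero _) (toF p)

theorem embed_apply (u : Bool × ℤ) (p : Polynomial (Polynomial ℂ)) (n : ℕ) :
    embed u p n = Finsupp.single u (p.coeff n) := by
  simp [embed, toF]

theorem embed_zero (u : Bool × ℤ) : embed u 0 = 0 := by
  ext1 n
  simp [embed_apply]

theorem embed_add (u : Bool × ℤ) (p q : Polynomial (Polynomial ℂ)) :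
    embed u (p + q) = embed u p + embed u q := by
  ext1 n
  simp [embed_apply]

theorem embed_neg (u : Bool × ℤ) (p : Polynomial (Polynomial ℂ)) :
    embed u (-p) = -embed u p := by
  ext1 n
  simp [embed_apply]

theorem embed_cc_mul (u : Bool × ℤ) (c : ℂ) (p : Polynomial (Polynomial ℂ)) :
    embed u (cc c * p) = c • embed u p := by
  ext1 n
  simp [embed_apply, cc, Polynomial.smul_eq_C_mul]

theorem embed_vpl_mul (u : Bool × ℤ) (p : Polynomial (Polynomial ℂ)) :
    embed u (vpl * p) = shift1L (embed u p) := by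
  ext1 n
  cases n with
  | zero =>
    rw [shift1L, Finsupp.lmapDomain_apply, Finsupp.mapDomain_of_notMem_range]
    · simp [embed_apply, vpl]
    · simp
  | succ n =>
    rw [shift1L, Finsupp.lmapDomain_apply, Finsupp.mapDomain_apply (add_left_injective 1)]
    simp [embed_apply, vpl]

theorem DW_single (u : Bool × ℤ) (p : Polynomial ℂ) :
    DW (Finsupp.single u p) = Finsupp.single u (Polynomial.X * p) := by
  simp [DW]

theorem embed_vpd_mul (u : Bool × ℤ) (p : Polynomial (Polynomial ℂ)) :
    embed u (vpd * p) = D1L DW (embed u p) := by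
  ext1 n
  simp [embed_apply, vpd, D1L, DW_single]

theorem BW_eq_sum (b : ℂ) (f g : WR) :
    BW b f g = f.sum fun s p => g.sum fun t q => embed (s.1 || t.1, s.2 + t.2)
      ((p.eval₂ cc (-vpl)) * (q.eval₂ cc (vpd + vpl)) * wFactor b s.1 t.1) :=
  rfl

theorem BW_single_left (b : ℂ) (s : Bool × ℤ) (p : Polynomial ℂ) (g : WR) :
    BW b (Finsupp.single s p) g = g.sum fun t q => embed (s.1 || t.1, s.2 + t.2)
      ((p.eval₂ cc (-vpl)) * (q.eval₂ cc (vpd + vpl)) * wFactor b s.1 t.1) := by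
  rw [BW_eq_sum, Finsupp.sum_single_index]
  simp [embed_zero]

theorem BW_single_single (b : ℂ) (s t : Bool × ℤ) (p q : Polynomial ℂ) :
    BW b (Finsupp.single s p) (Finsupp.single t q) = embed (s.1 || t.1, s.2 + t.2)
      ((p.eval₂ cc (-vpl)) * (q.eval₂ cc (vpd + vpl)) * wFactor b s.1 t.1) := by
  rw [BW_single_left, Finsupp.sum_single_index]
  simp [embed_zero]

theorem BW_add_left (b : ℂ) (x x' y : WR) : BW b (x + x') y = BW b x y + BW b x' y := by
  simp only [BW_eq_sum]
  rw [Finsupp.sum_add_index']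
  · simp [embed_zero]
  · intro s p p'
    simp only [Polynomial.eval₂_add, add_mul, embed_add, Finsupp.sum_add]

theorem BW_add_right (b : ℂ) (x y y' : WR) : BW b x (y + y') = BW b x y + BW b x y' := by
  simp only [BW_eq_sum]
  rw [← Finsupp.sum_add]
  refine Finsupp.sum_congr fun s _ => ?_
  rw [Finsupp.sum_add_index']
  · simp [embed_zero]
  · intro t q q'
    simp only [Polynomial.eval₂_add, add_mul, mul_add, embed_add]

/-- Biadditive identities on `CLW(a,b)` can be checked on the elements `p(∂)u`. -/
theorem WR_induction₂ {P : WR → WR → Prop} (zero_left : ∀ y, P 0 y) (zero_right : ∀ x, P x 0)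
    (add_left : ∀ x x' y, P x y → P x' y → P (x + x') y)
    (add_right : ∀ x y y', P x y → P x y' → P x (y + y'))
    (single : ∀ s t p q, P (Finsupp.single s p) (Finsupp.single t q)) (x y : WR) : P x y := by
  induction x using Finsupp.induction_linear with
  | zero => exact zero_left y
  | add x x' h h' => exact add_left x x' y h h'
  | single s p =>
    induction y using Finsupp.induction_linear with
    | zero => exact zero_right _
    | add y y' h h' => exact add_right _ y y' h h'
    | single t q => exact single s t p q

theorem BW_zero_left (b : ℂ) (y : WR) : BW b 0 y = 0 := by
  simp [BW]

theorem BW_zero_right (b : ℂ) (x : WR) : BW b x 0 = 0 := by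
  simp [BW]

theorem isConfBilinear_BW (b : ℂ) : IsConfBilinear DW (BW b) where
  add_left := BW_add_left b
  add_right := BW_add_right b
  smul_left c := by
    refine WR_induction₂ (by simp [BW_zero_left]) (by simp [BW_zero_right]) ?_ ?_ ?_
    · intro x x' y h h'
      rw [smul_add, BW_add_left, BW_add_left, h, h', smul_add]
    · intro x y y' h h'
      rw [BW_add_right, BW_add_right, h, h', smul_add]
    · intro s t p q
      rw [Finsupp.smul_single, BW_single_single, BW_single_single, ← embed_cc_mul,
        Polynomial.eval₂_smul]
      congr 1
      ring
  smul_right c := by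
    refine WR_induction₂ (by simp [BW_zero_left]) (by simp [BW_zero_right]) ?_ ?_ ?_
    · intro x x' y h h'
      rw [BW_add_left, BW_add_left, h, h', smul_add]
    · intro x y y' h h'
      rw [smul_add, BW_add_right, BW_add_right, h, h', smul_add]
    · intro s t p q
      rw [Finsupp.smul_single, BW_single_single, BW_single_single, ← embed_cc_mul,
        Polynomial.eval₂_smul]
      congr 1
      ring
  d_left := by
    change ∀ x y, BW b (DW x) y = -shift1L (BW b x y)
    refine WR_induction₂ (by simp [BW_zero_left]) (by simp [BW_zero_right]) ?_ ?_ ?_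
    · intro x x' y h h'
      rw [map_add, BW_add_left, BW_add_left, h, h', map_add, neg_add]
    · intro x y y' h h'
      rw [BW_add_right, BW_add_right, h, h', map_add, neg_add]
    · intro s t p q
      rw [DW_single, BW_single_single, BW_single_single, ← embed_vpl_mul, ← embed_neg,
        Polynomial.eval₂_mul, Polynomial.eval₂_X]
      congr 1
      ring
  d_right := by
    change ∀ x y, BW b x (DW y) = D1L DW (BW b x y) + shift1L (BW b x y)
    refine WR_induction₂ (by simp [BW_zero_left]) (by simp [BW_zero_right]) ?_ ?_ ?_
    · intro x x' y h h'
      rw [BW_add_left, BW_add_left, h, h', map_add, map_add]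
      abel
    · intro x y y' h h'
      rw [map_add, BW_add_right, BW_add_right, h, h', map_add, map_add]
      abel
    · intro s t p q
      rw [DW_single, BW_single_single, BW_single_single, ← embed_vpl_mul, ← embed_vpd_mul,
        ← embed_add, Polynomial.eval₂_mul, Polynomial.eval₂_X]
      congr 1
      ring

theorem generates_WR : Generates DW (Set.range fun u : Bool × ℤ => Finsupp.single u 1) := by
  intro P gen add smul d x
  induction x using Finsupp.induction_linear with
  | zero => simpa using smul 0 _ (gen _ ⟨(false, 0), rfl⟩)
  | add x y hx hy => exact add x y hx hy
  | single u p =>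
    induction p using Polynomial.induction_on with
    | C a => simpa [Polynomial.smul_eq_C_mul] using smul a _ (gen _ ⟨u, rfl⟩)
    | add p q hp hq => simpa using add _ _ hp hq
    | monomial n a h =>
      have := d _ h
      rwa [DW_single, show Polynomial.X * (Polynomial.C a * Polynomial.X ^ n) =
        Polynomial.C a * Polynomial.X ^ (n + 1) by ring] at this

/-- The coefficient of `∂` in the bracket of two generators. -/
def coeffD (b : ℂ) : Bool → Bool → ℂ
  | false, _ => 1
  | true, false => -b
  | true, true => 0

/-- The coefficient of `λ` in the bracket of two generators. -/
def coeffL (b : ℂ) : Bool → Bool → ℂ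
  | false, false => 2
  | false, true => 1 - b
  | true, false => 1 - b
  | true, true => 0

theorem wFactor_eq (b : ℂ) (i j : Bool) :
    wFactor b i j = vpd * cc (coeffD b i j) + vpl * cc (coeffL b i j) := by
  cases i <;> cases j <;> simp [wFactor, coeffD, coeffL, map_ofNat] <;> ring

theorem embed_cc (u : Bool × ℤ) (c : ℂ) :
    embed u (cc c) = Finsupp.single 0 (c • Finsupp.single u 1) := by
  ext1 n
  rw [embed_apply]
  by_cases hn : n = 0
  · simp [hn, cc, Polynomial.smul_eq_C_mul]
  · simp [cc, Polynomial.coeff_C, hn]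

theorem BW_generators (b : ℂ) (s t : Bool × ℤ) :
    (isConfBilinear_BW b).toLinear (Finsupp.single s 1) (Finsupp.single t 1) =
      D1L DW (Finsupp.single 0 (coeffD b s.1 t.1 • Finsupp.single (s.1 || t.1, s.2 + t.2) 1)) +
      shift1L
        (Finsupp.single 0 (coeffL b s.1 t.1 • Finsupp.single (s.1 || t.1, s.2 + t.2) 1)) := by
  change BW b _ _ = _
  rw [BW_single_single, wFactor_eq, ← embed_cc, ← embed_cc, ← embed_vpd_mul, ← embed_vpl_mul,
    ← embed_add]
  simp

theorem evL_BW_generators (b : ℂ) {E : Module.End ℂ (Pol3 WR)} (hE : Commute (D3L DW) E)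
    (s t : Bool × ℤ) :
    evL E ((isConfBilinear_BW b).toLinear (Finsupp.single s 1) (Finsupp.single t 1)) =
      coeffD b s.1 t.1 • D3L DW (iota3L (Finsupp.single (s.1 || t.1, s.2 + t.2) 1)) +
      coeffL b s.1 t.1 • E (iota3L (Finsupp.single (s.1 || t.1, s.2 + t.2) 1)) := by
  rw [BW_generators, map_add, evL_D1L DW hE, evL_shift1L]
  simp only [evL_single, pow_zero, Module.End.one_apply, map_smul]

theorem skew_BW_generators (b : ℂ) (s t : Bool × ℤ) :
    (isConfBilinear_BW b).toLinear (Finsupp.single s 1) (Finsupp.single t 1) =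
      -ev1L (subNegL DW)
        ((isConfBilinear_BW b).toLinear (Finsupp.single t 1) (Finsupp.single s 1)) := by
  rw [BW_generators, BW_generators, map_add, ev1L_D1L DW (commute_D1L_subNegL DW), ev1L_shift1L]
  simp only [ev1L_single, pow_zero, Module.End.one_apply, ← Finsupp.smul_single, map_smul]
  obtain ⟨i, m⟩ := s
  obtain ⟨j, n⟩ := t
  rw [add_comm n m, Bool.or_comm j i]
  cases i <;> cases j <;>
    simp only [coeffD, coeffL, subNegL, LinearMap.sub_apply, LinearMap.neg_apply] <;> module

theorem jacobi_BW_generators (b : ℂ) (s t u : Bool × ℤ) :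
    JacobiAt (isConfBilinear_BW b).toLinear (Finsupp.single s 1) (Finsupp.single t 1)
      (Finsupp.single u 1) := by
  have hl := commute_D3L_XlL DW
  have hm := commute_D3L_XmL DW
  have hlm := hl.add_right hm
  have dl : ∀ x y, (isConfBilinear_BW b).toLinear (DW x) y =
      -shift1L ((isConfBilinear_BW b).toLinear x y) := (isConfBilinear_BW b).d_left
  have dr : ∀ x y, (isConfBilinear_BW b).toLinear x (DW y) =
      D1L DW ((isConfBilinear_BW b).toLinear x y) +
        shift1L ((isConfBilinear_BW b).toLinear x y) := (isConfBilinear_BW b).d_right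
  unfold JacobiAt
  rw [evL_BW_generators b hm, evL_BW_generators b hl, evL_BW_generators b hl]
  simp only [map_add, map_smul, lift3L_XlL, lift3L_XmL, lift3L_evL_D_left dl,
    lift3L_evL_D_right dr _ hl (Commute.refl _) commute_XlL_XmL commute_XlL_XgL,
    lift3L_evL_D_right dr _ hm commute_XlL_XmL.symm (Commute.refl _) commute_XmL_XgL,
    lift3L_iota3L, LinearMap.comp_apply, LinearMap.flip_apply,
    evL_BW_generators b hl, evL_BW_generators b hm, evL_BW_generators b hlm, LinearMap.add_apply,
    XmL_XlL, D3L_XlL, D3L_XmL]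
  obtain ⟨i, m⟩ := s
  obtain ⟨j, n⟩ := t
  obtain ⟨k, o⟩ := u
  rw [show n + (m + o) = m + (n + o) by ring, show m + n + o = m + (n + o) by ring]
  cases i <;> cases j <;> cases k <;>
    simp only [coeffD, coeffL, Bool.or_false, Bool.or_true] <;> module

end LoopW

/-- for fixed `a, b ∈ ℂ`, the free `ℂ[∂]`-module `CLW(a,b)` with the
λ-brackets `[L_i λ L_j] = (∂+2λ)L_{i+j}`, `[L_i λ G_j] = (∂+(1-b)λ)G_{i+j}`,
`[G_i λ L_j] = -(b∂+(b-1)λ)G_{i+j}`, `[G_i λ G_j] = 0` (extended by conformal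
sesquilinearity; the bracket does not involve `a`) is a Lie conformal algebra. -/
theorem clw_isLieConformal (a b : ℂ) : IsLieConformal DW (BW b) := by
  refine (isConfBilinear_BW b).isLieConformal generates_WR ?_ ?_
  · rintro _ ⟨s, rfl⟩ _ ⟨t, rfl⟩
    exact skew_BW_generators b s t
  · rintro _ ⟨s, rfl⟩ _ ⟨t, rfl⟩ _ ⟨u, rfl⟩
    exact jacobi_BW_generators b s t u

end ConfBider
end

section
/- Every conformal biderivation φ of the loop Virasoro Lie conformal algebra CW satisfies: there exists a family of complex numbers (a_k)_{k∈Z}, with only finitely many nonzero among those appearing in each value, such that φ_λ(L_i, L_j) = (∂ + 2λ) Σ_{k∈Z} a_{k-i-j} L_k for all i, j ∈ Z. Conversely, any skew-symmetric conformal bilinear map of this form is a conformal biderivation of CW. -/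
/- Framework: a Lie conformal algebra over ℂ is a ℂ[∂]-module `R` (given by a ℂ-module
with a ℂ-linear operator `D` for the action of `∂`) with a λ-bracket `B : R → R → R[λ]`.
We model `R[λ]` as `ℕ →₀ R` (coefficient of `λ^n` at index `n`) and `R[λ,μ,γ]` as an
iterated Finsupp.  Substitutions of the bracket variable are implemented by evaluating
the polynomial at a commuting operator (e.g. multiplication by `λ`, by `λ+μ`, or by
`-∂-λ`), and brackets/biderivations are extended to polynomial-valued arguments by
ℂ[λ,μ,γ]-bilinearity. -/

namespace ConfBider

variable {R : Type} [AddCommGroup R] [Module ℂ R]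

/-- The loop Virasoro conformal algebra `CW = ⊕_{i∈ℤ} ℂ[∂]L_i` as a free `ℂ[∂]`-module. -/
abbrev CWR : Type := ℤ →₀ Polynomial ℂ

/-- The action of `∂` on `CW`. -/
noncomputable def DCW : CWR →ₗ[ℂ] CWR :=
  Finsupp.mapRange.linearMap (LinearMap.mulLeft ℂ (Polynomial.X : Polynomial ℂ))

/-- The basis element `L i`. -/
noncomputable def Lcw (i : ℤ) : CWR := Finsupp.single i (1 : Polynomial ℂ)

/-- The λ-bracket of `CW`, determined by `[L_i λ L_j] = (∂+2λ)L_{i+j}` and conformal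
sesquilinearity: `[p(∂)L_i λ q(∂)L_j] = p(-λ)q(∂+λ)(∂+2λ)L_{i+j}`. -/
noncomputable def BCW (f g : CWR) : Pol1 CWR :=
  f.sum fun i p => g.sum fun j q =>
    Finsupp.mapRange (fun c => Finsupp.single (i + j) c) (Finsupp.single_zero _)
      (toF ((p.eval₂ cc (-vpl)) * (q.eval₂ cc (vpd + vpl)) * (vpd + 2 * vpl)))

/-- The element `Σ_k a_{k-i-j} L_k ∈ CW` for a finitely supported family `a`. -/
noncomputable def Scw (a : ℤ →₀ ℂ) (i j : ℤ) : CWR :=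
  a.sum fun m c => Finsupp.single (m + i + j) (Polynomial.C c)

/-- `(∂+2λ)·x ∈ CW[λ]`. -/
noncomputable def d2l (x : CWR) : Pol1 CWR :=
  Finsupp.single 0 (DCW x) + Finsupp.single 1 ((2 : ℂ) • x)

section

open Polynomial

section Evaluation

variable {M N : Type*} [AddCommGroup M] [Module ℂ M] [AddCommGroup N] [Module ℂ N]

/-- Apply `T` to the coefficients of a polynomial with coefficients in `M` and evaluate the
variable at `l`. -/
noncomputable def evalVar (l : ℂ) (T : M →ₗ[ℂ] N) : (ℕ →₀ M) →ₗ[ℂ] N :=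
  Finsupp.lsum ℂ fun n => l ^ n • T

theorem evalVar_apply (l : ℂ) (T : M →ₗ[ℂ] N) (w : ℕ →₀ M) :
    evalVar l T w = ∑ n ∈ w.support, l ^ n • T (w n) := rfl

theorem evalVar_single (l : ℂ) (T : M →ₗ[ℂ] N) (n : ℕ) (x : M) :
    evalVar l T (Finsupp.single n x) = l ^ n • T x := by
  simp [evalVar]

theorem evalVar_smul (l : ℂ) (c : ℂ) (T : M →ₗ[ℂ] N) (w : ℕ →₀ M) :
    evalVar l (c • T) w = c • evalVar l T w := by
  induction w using Finsupp.induction_linear with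
  | zero => simp
  | add f g hf hg => rw [map_add, map_add, hf, hg, smul_add]
  | single n x => simp only [evalVar_single, LinearMap.smul_apply, smul_comm c]

theorem map_evalVar {P : Type*} [AddCommGroup P] [Module ℂ P] (l : ℂ) (T : M →ₗ[ℂ] N)
    (S : N →ₗ[ℂ] P) (w : ℕ →₀ M) : S (evalVar l T w) = evalVar l (S ∘ₗ T) w := by
  induction w using Finsupp.induction_linear with
  | zero => simp
  | add f g hf hg => simp only [map_add, hf, hg]
  | single n x => simp [evalVar_single]

theorem evalVar_mapDomain_succ (l : ℂ) (T : M →ₗ[ℂ] N) (w : ℕ →₀ M) :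
    evalVar l T (Finsupp.mapDomain (· + 1) w) = l • evalVar l T w := by
  induction w using Finsupp.induction_linear with
  | zero => simp
  | add f g hf hg => rw [Finsupp.mapDomain_add, map_add, hf, hg, map_add, smul_add]
  | single n x => rw [Finsupp.mapDomain_single, evalVar_single, evalVar_single, pow_succ', mul_smul]

theorem evalVar_mapRange {K : Type*} [AddCommGroup K] [Module ℂ K] (l c : ℂ) (T : M →ₗ[ℂ] N)
    (T' : K →ₗ[ℂ] N) (s : K → M) (h0 : s 0 = 0) (h : ∀ x, T (s x) = c • T' x) (w : ℕ →₀ K) :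
    evalVar l T (Finsupp.mapRange s h0 w) = c • evalVar l T' w := by
  simp only [evalVar, Finsupp.lsum_apply]
  rw [Finsupp.sum_mapRange_index (by simp), Finsupp.smul_sum]
  simp only [LinearMap.smul_apply, h, smul_comm c]

theorem linearIndependent_zpow :
    LinearIndependent ℂ (fun (n : ℤ) (z : ℂˣ) => ((z ^ n : ℂˣ) : ℂ)) := by
  have h := (linearIndependent_monoidHom ℂˣ ℂ).comp
    (fun n : ℤ => (Units.coeHom ℂ).comp (zpowGroupHom n)) (fun a b hab => by
      have := DFunLike.congr_fun hab (Units.mk0 (2 : ℂ) two_ne_zero)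
      simp only [MonoidHom.comp_apply, zpowGroupHom_apply, Units.coeHom_apply,
        Units.val_zpow_eq_zpow_val, Units.val_mk0] at this
      have h2 := congrArg norm this
      simp only [norm_zpow, Complex.norm_ofNat] at h2
      exact zpow_right_injective₀ (by norm_num) (by norm_num) h2)
  exact h

theorem linearIndependent_pow :
    LinearIndependent ℂ (fun (n : ℕ) (z : ℂˣ) => (z : ℂ) ^ n) := by
  have h := linearIndependent_zpow.comp (fun n : ℕ => (n : ℤ)) Nat.cast_injective
  convert h using 2
  ext z
  simp

theorem evalVar_ext (T : M →ₗ[ℂ] ℂ) {v w : ℕ →₀ M}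
    (h : ∀ l : ℂˣ, evalVar (l : ℂ) T v = evalVar (l : ℂ) T w) (n : ℕ) : T (v n) = T (w n) := by
  have key : (v - w).mapRange T (map_zero T) = 0 := by
    refine linearIndependent_iff.mp linearIndependent_pow _ ?_
    ext l
    have hl : evalVar (l : ℂ) T (v - w) = 0 := by rw [map_sub, h, sub_self]
    rw [Finsupp.linearCombination_apply, Finsupp.sum_mapRange_index (by simp)]
    simp only [evalVar, Finsupp.lsum_apply] at hl
    rw [Pi.zero_apply, ← hl, Finsupp.sum, Finset.sum_apply]
    exact Finset.sum_congr rfl fun _ _ => mul_comm _ _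
  have := DFunLike.congr_fun key n
  simpa [sub_eq_zero] using this

end Evaluation

/-- Evaluation of `L_i` at `z ^ i`, with values in `ℂ[∂]`. -/
noncomputable def loopPoly (z : ℂˣ) : CWR →ₗ[ℂ] ℂ[X] :=
  Finsupp.lsum ℂ fun i => ((z ^ i : ℂˣ) : ℂ) • LinearMap.id

/-- Evaluation of `L_i` at `z ^ i` and of `∂` at `d`. -/
noncomputable def evalCW (z : ℂˣ) (d : ℂ) : CWR →ₗ[ℂ] ℂ := leval d ∘ₗ loopPoly z

theorem evalCW_single (z : ℂˣ) (d : ℂ) (i : ℤ) (p : ℂ[X]) :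
    evalCW z d (Finsupp.single i p) = ((z ^ i : ℂˣ) : ℂ) * p.eval d := by
  simp [evalCW, loopPoly]

theorem evalCW_Lcw (z : ℂˣ) (d : ℂ) (i : ℤ) : evalCW z d (Lcw i) = ((z ^ i : ℂˣ) : ℂ) := by
  simp [Lcw, evalCW_single]

theorem evalCW_DCW (z : ℂˣ) (d : ℂ) (x : CWR) : evalCW z d (DCW x) = d * evalCW z d x := by
  induction x using Finsupp.induction_linear with
  | zero => simp
  | add f g hf hg => rw [map_add, map_add, hf, hg, map_add, mul_add]
  | single i p =>
    simp only [DCW, Finsupp.mapRange.linearMap_apply, Finsupp.mapRange_single, evalCW_single,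
      LinearMap.mulLeft_apply, eval_mul, eval_X]
    ring

theorem evalCW_ext {x y : CWR} (h : ∀ z d, evalCW z d x = evalCW z d y) : x = y := by
  rw [← sub_eq_zero]
  ext1 i
  refine Polynomial.funext fun d => ?_
  have key : (x - y).mapRange (leval d) (map_zero _) = 0 := by
    refine linearIndependent_iff.mp linearIndependent_zpow _ ?_
    ext z
    have hl : evalCW z d (x - y) = 0 := by rw [map_sub, h, sub_self]
    rw [Finsupp.linearCombination_apply, Finsupp.sum_mapRange_index (by simp), Pi.zero_apply,
      ← hl, evalCW, LinearMap.comp_apply, loopPoly, Finsupp.lsum_apply, Finsupp.sum, Finsupp.sum,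
      map_sum, Finset.sum_apply]
    exact Finset.sum_congr rfl fun _ _ => by simp [mul_comm]
  simpa using DFunLike.congr_fun key i

theorem CWR_induction {P : CWR → Prop} (add : ∀ x y, P x → P y → P (x + y))
    (smul : ∀ (c : ℂ) x, P x → P (c • x)) (deriv : ∀ x, P x → P (DCW x))
    (basis : ∀ i, P (Lcw i)) (x : CWR) : P x := by
  induction x using Finsupp.induction_linear with
  | zero => simpa using smul 0 _ (basis 0)
  | add f g hf hg => exact add f g hf hg
  | single i p =>
    induction p using Polynomial.induction_on with
    | C c => simpa [Lcw, smul_eq_C_mul] using smul c _ (basis i)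
    | add p q hp hq => rw [Finsupp.single_add]; exact add _ _ hp hq
    | monomial n c h =>
      have := deriv _ h
      simp only [DCW, Finsupp.mapRange.linearMap_apply, Finsupp.mapRange_single,
        LinearMap.mulLeft_apply] at this
      convert this using 2
      ring

/-- Evaluation of `CW[λ]` at `λ = l`, `∂ = d` and `L_i = z ^ i`. -/
noncomputable def evalPol1 (z : ℂˣ) (d l : ℂ) : Pol1 CWR →ₗ[ℂ] ℂ := evalVar l (evalCW z d)

theorem evalPol1_ext {v w : Pol1 CWR}
    (h : ∀ (z : ℂˣ) (d : ℂ) (l : ℂˣ), evalPol1 z d l v = evalPol1 z d l w) : v = w := by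
  ext1 n
  exact evalCW_ext fun z d => evalVar_ext _ (h z d) n

theorem evalPol1_shift1 (z : ℂˣ) (d l : ℂ) (w : Pol1 CWR) :
    evalPol1 z d l (shift1 w) = l * evalPol1 z d l w :=
  evalVar_mapDomain_succ _ _ _

theorem evalPol1_D1 (z : ℂˣ) (d l : ℂ) (w : Pol1 CWR) :
    evalPol1 z d l (D1 DCW w) = d * evalPol1 z d l w :=
  evalVar_mapRange _ _ _ _ _ _ (evalCW_DCW z d) _

theorem evalPol1_d2l (z : ℂˣ) (d l : ℂ) (x : CWR) :
    evalPol1 z d l (d2l x) = (d + 2 * l) * evalCW z d x := by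
  simp only [d2l, evalPol1, map_add, evalVar_single, evalCW_DCW, map_smul, smul_eq_mul]
  ring

theorem evalPol1_ev1_subNeg (z : ℂˣ) (d l : ℂ) (w : Pol1 CWR) :
    evalPol1 z d l (ev1 w (subNeg DCW)) = evalPol1 z d (-d - l) w := by
  have hit (n : ℕ) (v : Pol1 CWR) :
      evalPol1 z d l ((subNeg DCW)^[n] v) = (-d - l) ^ n * evalPol1 z d l v := by
    induction n with
    | zero => simp
    | succ n ih =>
      rw [Function.iterate_succ_apply', subNeg, map_sub, map_neg, evalPol1_D1, evalPol1_shift1,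
        ih]
      ring
  rw [ev1, Finsupp.sum, map_sum]
  simp only [hit]
  simp only [evalPol1, evalVar_single, pow_zero, one_smul]
  rfl

theorem evalVar_toF (d l c : ℂ) (p : ℂ[X][X]) :
    evalVar l (c • leval d) (toF p) = c * p.evalEval d l := by
  rw [evalVar_smul, smul_eq_mul]
  congr 1
  rw [evalEval, eval_eq_sum (p := p), Polynomial.sum, eval_finsetSum, evalVar_apply]
  refine Finset.sum_subset_zero_on_sdiff (fun n hn => ?_) (fun n hn => ?_) (fun n hn => ?_)
  · simpa [toF] using hn
  · simp only [toF, Finset.mem_sdiff, Finsupp.mem_support_iff, Finsupp.onFinset_apply,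
      not_not] at hn
    simp [hn.2]
  · simp [toF, mul_comm]

theorem evalPol1_BCW (z : ℂˣ) (d l : ℂ) (x y : CWR) :
    evalPol1 z d l (BCW x y) = evalCW z (-l) x * evalCW z (d + l) y * (d + 2 * l) := by
  have hcc : (evalEvalRingHom d l).comp cc = RingHom.id ℂ := by ext c; simp [cc]
  have hpd : evalEvalRingHom d l vpd = d := by simp [vpd]
  have hpl : evalEvalRingHom d l vpl = l := by simp [vpl]
  have term (i j : ℤ) (p q : ℂ[X]) : evalPol1 z d l
      (Finsupp.mapRange (fun c => Finsupp.single (i + j) c) (Finsupp.single_zero _)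
        (toF ((p.eval₂ cc (-vpl)) * (q.eval₂ cc (vpd + vpl)) * (vpd + 2 * vpl)))) =
      ((z ^ i : ℂˣ) * p.eval (-l)) * ((z ^ j : ℂˣ) * q.eval (d + l)) * (d + 2 * l) := by
    rw [evalPol1, evalVar_mapRange l ((z ^ (i + j) : ℂˣ) : ℂ) _ (leval d) _ _
      (fun p => by simp [evalCW_single]), ← evalVar_smul, evalVar_toF,
      ← coe_evalEvalRingHom]
    simp only [map_mul, map_add, hom_eval₂, hcc, hpd, hpl, map_neg, map_ofNat, eval₂_id, zpow_add,
      Units.val_mul]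
    ring
  rw [BCW, Finsupp.sum, map_sum]
  simp only [Finsupp.sum, map_sum, term]
  simp only [evalCW, LinearMap.comp_apply, loopPoly, Finsupp.lsum_apply, Finsupp.sum, map_sum,
    LinearMap.smul_apply, LinearMap.id_apply, map_smul, smul_eq_mul, leval_apply,
    Finset.sum_mul, Finset.mul_sum]
  exact Finset.sum_comm

theorem BCW_Lcw (i j : ℤ) : BCW (Lcw i) (Lcw j) = d2l (Lcw (i + j)) :=
  evalPol1_ext fun z d l => by
    rw [evalPol1_BCW, evalPol1_d2l, evalCW_Lcw, evalCW_Lcw, evalCW_Lcw, zpow_add, Units.val_mul]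
    ring

/-- Apply `S` to the coefficients of an element of `CW[λ,μ,γ]` and evaluate at
`λ = l`, `μ = m`, `γ = g`. -/
noncomputable def evalPol3 (l m g : ℂ) (S : CWR →ₗ[ℂ] ℂ) : Pol3 CWR →ₗ[ℂ] ℂ :=
  evalVar l (evalVar m (evalVar g S))

theorem evalPol3_ext {v w : Pol3 CWR} (h : ∀ (z : ℂˣ) (d : ℂ) (l m g : ℂˣ),
    evalPol3 l m g (evalCW z d) v = evalPol3 l m g (evalCW z d) w) : v = w := by
  ext1 a
  ext1 b
  ext1 c
  exact evalCW_ext fun z d => evalVar_ext _ (fun g => evalVar_ext _ (fun m =>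
    evalVar_ext _ (fun l => h z d l m g) a) b) c

section Pol3

variable (l m g : ℂ) (S : CWR →ₗ[ℂ] ℂ)

theorem evalPol3_Xl (w : Pol3 CWR) : evalPol3 l m g S (Xl w) = l * evalPol3 l m g S w :=
  evalVar_mapDomain_succ _ _ _

theorem evalPol3_Xm (w : Pol3 CWR) : evalPol3 l m g S (Xm w) = m * evalPol3 l m g S w :=
  evalVar_mapRange _ _ _ _ _ _ (evalVar_mapDomain_succ _ _) _

theorem evalPol3_Xg (w : Pol3 CWR) : evalPol3 l m g S (Xg w) = g * evalPol3 l m g S w :=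
  evalVar_mapRange _ _ _ _ _ _ (evalVar_mapRange _ _ _ _ _ _ (evalVar_mapDomain_succ _ _)) _

theorem evalPol3_eLM (w : Pol3 CWR) :
    evalPol3 l m g S (eLM w) = (l + m) * evalPol3 l m g S w := by
  rw [eLM, map_add, evalPol3_Xl, evalPol3_Xm, add_mul]

theorem map_iterate_of_map_mul (T : Pol3 CWR →ₗ[ℂ] ℂ) {e : Pol3 CWR → Pol3 CWR} {t : ℂ}
    (he : ∀ w, T (e w) = t * T w) (n : ℕ) (w : Pol3 CWR) : T (e^[n] w) = t ^ n * T w := by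
  induction n with
  | zero => simp
  | succ n ih => rw [Function.iterate_succ_apply', he, ih, pow_succ']; ring

theorem evalPol3_ev {e : Pol3 CWR → Pol3 CWR} {t : ℂ}
    (he : ∀ w, evalPol3 l m g S (e w) = t * evalPol3 l m g S w) (f : Pol1 CWR) :
    evalPol3 l m g S (ev f e) = evalVar t S f := by
  rw [ev, Finsupp.sum, map_sum]
  simp only [map_iterate_of_map_mul _ he]
  simp only [evalPol3, iota3, evalVar_single, pow_zero, one_smul]
  rfl

theorem evalPol3_lift3 (z : ℂˣ) (d : ℂ) {F : CWR → Pol3 CWR}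
    (hF : ∀ r, evalPol3 l m g (evalCW z d) (F r) = S r) (w : Pol3 CWR) :
    evalPol3 l m g (evalCW z d) (lift3 F w) = evalPol3 l m g S w := by
  simp only [lift3, Finsupp.sum, map_sum,
    map_iterate_of_map_mul _ (evalPol3_Xl l m g (evalCW z d)),
    map_iterate_of_map_mul _ (evalPol3_Xm l m g (evalCW z d)),
    map_iterate_of_map_mul _ (evalPol3_Xg l m g (evalCW z d)), hF]
  simp [evalPol3, evalVar, Finsupp.sum, Finset.mul_sum]

end Pol3

theorem eq_linear_of_eval_two_mul {p : ℂ[X]} (h : ∀ t, p.eval (2 * t) = 2 * p.eval t) (t : ℂ) :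
    p.eval t = p.coeff 1 * t := by
  have hp : p.comp (C 2 * X) = C 2 * p := Polynomial.funext fun t => by simp [h]
  have hc (n : ℕ) (hn : n ≠ 1) : p.coeff n = 0 := by
    have h1 := congrArg (coeff · n) hp
    simp only [comp_C_mul_X_coeff, coeff_C_mul] at h1
    have h2 : (2 : ℂ) ^ n ≠ 2 := fun h => hn (by
      have h3 : (2 : ℕ) ^ n = 2 ^ 1 := by exact_mod_cast h
      exact Nat.pow_right_injective le_rfl h3)
    have h3 : p.coeff n * ((2 : ℂ) ^ n - 2) = 0 := by linear_combination h1
    exact (mul_eq_zero.mp h3).resolve_right (sub_ne_zero.mpr h2)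
  have hpc : p = C (p.coeff 1) * X := by
    ext n
    rcases eq_or_ne n 1 with rfl | hn
    · simp
    · simp [hc n hn, coeff_X, hn.symm]
  conv_lhs => rw [hpc]
  simp

section Bilinear

variable {φ : CWR → CWR → Pol1 CWR}

/-- The linear map `y ↦ φ_λ(x, y)`, evaluated at a point. -/
noncomputable def IsConfBilinear.evalRight (h : IsConfBilinear DCW φ) (z : ℂˣ) (d l : ℂ)
    (x : CWR) : CWR →ₗ[ℂ] ℂ where
  toFun y := evalPol1 z d l (φ x y)
  map_add' y y' := by rw [h.add_right, map_add]
  map_smul' c y := by rw [h.smul_right, map_smul, RingHom.id_apply]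

theorem IsConfBilinear.evalPol1_d_left (h : IsConfBilinear DCW φ) (z : ℂˣ) (d l : ℂ) (x y : CWR) :
    evalPol1 z d l (φ (DCW x) y) = -l * evalPol1 z d l (φ x y) := by
  rw [h.d_left, map_neg, evalPol1_shift1, neg_mul]

theorem IsConfBilinear.evalPol1_d_right (h : IsConfBilinear DCW φ) (z : ℂˣ) (d l : ℂ)
    (x y : CWR) : evalPol1 z d l (φ x (DCW y)) = (d + l) * evalPol1 z d l (φ x y) := by
  rw [h.d_right, map_add, evalPol1_shift1, evalPol1_D1, add_mul]

theorem evalCW_Scw (a : ℤ →₀ ℂ) (i j : ℤ) (z : ℂˣ) (d : ℂ) :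
    evalCW z d (Scw a i j) =
      (z ^ i : ℂˣ) * (z ^ j : ℂˣ) * a.sum fun k c => c * (z ^ k : ℂˣ) := by
  simp only [Scw, Finsupp.sum, map_sum, evalCW_single, eval_C, zpow_add, Units.val_mul,
    Finset.mul_sum]
  exact Finset.sum_congr rfl fun _ _ => by ring

/-- A conformal bilinear map is determined by its values on the `L_i`. -/
theorem IsConfBilinear.evalPol1_eq (h : IsConfBilinear DCW φ) {a : ℤ →₀ ℂ}
    (ha : ∀ i j, φ (Lcw i) (Lcw j) = d2l (Scw a i j)) (z : ℂˣ) (d l : ℂ) (x y : CWR) :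
    evalPol1 z d l (φ x y) = evalCW z (-l) x * evalCW z (d + l) y * (d + 2 * l) *
      a.sum fun k c => c * (z ^ k : ℂˣ) := by
  induction x using CWR_induction with
  | add x x' hx hx' => rw [h.add_left, map_add, hx, hx', map_add]; ring
  | smul c x hx => rw [h.smul_left, map_smul, hx, map_smul, smul_eq_mul, smul_eq_mul]; ring
  | deriv x hx => rw [h.evalPol1_d_left, hx, evalCW_DCW]; ring
  | basis i =>
    induction y using CWR_induction with
    | add x x' hx hx' => rw [h.add_right, map_add, hx, hx', map_add]; ring
    | smul c x hx => rw [h.smul_right, map_smul, hx, map_smul, smul_eq_mul, smul_eq_mul]; ring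
    | deriv x hx => rw [h.evalPol1_d_right, hx, evalCW_DCW]; ring
    | basis j => rw [ha, evalPol1_d2l, evalCW_Scw, evalCW_Lcw, evalCW_Lcw]; ring

/-- The Leibniz rule, evaluated at a point. -/
theorem IsConfBilinear.evalPol3_leibniz (h : IsConfBilinear DCW φ) (z : ℂˣ) (d l m g : ℂ)
    (x y w : CWR) :
    evalPol3 l m g (evalCW z d) (lift3 (fun r => ev (φ x r) Xl) (ev (BCW y w) Xm)) =
        evalVar m (h.evalRight z d l x) (BCW y w) ∧
      evalPol3 l m g (evalCW z d) (lift3 (fun r => ev (BCW r w) eLM) (ev (φ x y) Xl)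
          + lift3 (fun r => ev (BCW y r) Xm) (ev (φ x w) Xl)) =
        evalPol1 z (-l - m) l (φ x y) * (evalCW z (d + l + m) w * (d + 2 * (l + m))) +
          evalPol1 z (d + m) l (φ x w) * (evalCW z (-m) y * (d + 2 * m)) := by
  constructor
  · rw [evalPol3_lift3 l m g (h.evalRight z d l x) z d
      (fun r => evalPol3_ev _ _ _ _ (evalPol3_Xl _ _ _ _) _),
      evalPol3_ev _ _ _ _ (evalPol3_Xm _ _ _ _)]
  · rw [map_add,
      evalPol3_lift3 l m g ((evalCW z (d + l + m) w * (d + 2 * (l + m))) • evalCW z (-l - m)) z d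
        (fun r => by
          rw [evalPol3_ev _ _ _ _ (evalPol3_eLM _ _ _ _)]
          refine (evalPol1_BCW z d (l + m) r w).trans ?_
          rw [neg_add', LinearMap.smul_apply, smul_eq_mul, add_assoc]
          ring),
      evalPol3_lift3 l m g ((evalCW z (-m) y * (d + 2 * m)) • evalCW z (d + m)) z d
        (fun r => by
          rw [evalPol3_ev _ _ _ _ (evalPol3_Xm _ _ _ _)]
          refine (evalPol1_BCW z d m y r).trans ?_
          rw [LinearMap.smul_apply, smul_eq_mul]
          ring),
      evalPol3_ev _ _ _ _ (evalPol3_Xl _ _ _ _), evalPol3_ev _ _ _ _ (evalPol3_Xl _ _ _ _),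
      evalVar_smul, evalVar_smul, smul_eq_mul, smul_eq_mul, evalPol1, evalPol1]
    ring

theorem IsConfBilinear.isConfBiderivation (h : IsConfBilinear DCW φ) (hs : IsSkew DCW φ)
    {a : ℤ →₀ ℂ} (ha : ∀ i j, φ (Lcw i) (Lcw j) = d2l (Scw a i j)) :
    IsConfBiderivation DCW BCW φ := by
  refine ⟨h, hs, fun x y w => evalPol3_ext fun z d l m g => ?_⟩
  have hright : h.evalRight z d l x = (evalCW z (-l) x * (d + 2 * l) *
      a.sum fun k c => c * (z ^ k : ℂˣ)) • evalCW z (d + l) := by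
    refine LinearMap.ext fun y => ?_
    refine (h.evalPol1_eq ha z d l x y).trans ?_
    rw [LinearMap.smul_apply, smul_eq_mul]
    ring
  rw [(h.evalPol3_leibniz z d l m g x y w).1, (h.evalPol3_leibniz z d l m g x y w).2, hright,
    evalVar_smul, ← evalPol1, evalPol1_BCW, h.evalPol1_eq ha, h.evalPol1_eq ha]
  rw [show (-l - m + l : ℂ) = -m by ring, show (d + m + l : ℂ) = d + l + m by ring, smul_eq_mul]
  ring

namespace IsConfBiderivation

theorem evalPol1_leibniz (h : IsConfBiderivation DCW BCW φ) (z : ℂˣ) (d l m : ℂ)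
    (i j n : ℤ) :
    (d + l + 2 * m) * evalPol1 z d l (φ (Lcw i) (Lcw (j + n))) =
      evalPol1 z (-l - m) l (φ (Lcw i) (Lcw j)) * ((z ^ n : ℂˣ) * (d + 2 * (l + m))) +
        evalPol1 z (d + m) l (φ (Lcw i) (Lcw n)) * ((z ^ j : ℂˣ) * (d + 2 * m)) := by
  have key := congrArg (evalPol3 l m 0 (evalCW z d)) (h.leibniz (Lcw i) (Lcw j) (Lcw n))
  rw [(h.bilin.evalPol3_leibniz z d l m 0 _ _ _).1, (h.bilin.evalPol3_leibniz z d l m 0 _ _ _).2,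
    BCW_Lcw, evalCW_Lcw, evalCW_Lcw] at key
  rw [← key, d2l, map_add, evalVar_single, evalVar_single, map_smul]
  change _ = m ^ 0 * evalPol1 z d l (φ _ (DCW _)) + m ^ 1 * (2 * evalPol1 z d l (φ _ _))
  rw [h.bilin.evalPol1_d_right]
  ring

theorem exists_evalPol1_eq_mul (h : IsConfBiderivation DCW BCW φ) (z : ℂˣ)
    {l : ℂ} (hl : l ≠ 0) (i n : ℤ) :
    ∃ c : ℂ, ∀ d, evalPol1 z d l (φ (Lcw i) (Lcw n)) = c * (d + 2 * l) := by
  set p : ℂ[X] := (evalVar l (loopPoly z) (φ (Lcw i) (Lcw n))).comp (X - C (2 * l)) with hp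
  have hev (t : ℂ) : p.eval t = evalPol1 z (t - 2 * l) l (φ (Lcw i) (Lcw n)) := by
    rw [hp, eval_comp, eval_sub, eval_X, eval_C, ← leval_apply, map_evalVar]
    rfl
  refine ⟨p.coeff 1, fun d => ?_⟩
  rw [← eq_linear_of_eval_two_mul (fun t => ?_), hev, add_sub_cancel_right]
  have key := h.evalPol1_leibniz z (2 * t - 2 * l) l (-t) i 0 n
  rw [zero_add, zpow_zero, Units.val_one,
    show (2 * t - 2 * l + -t : ℂ) = t - 2 * l by ring, ← hev, ← hev] at key
  refine mul_left_cancel₀ hl ?_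
  linear_combination -key

theorem exists_evalPol1_eq (h : IsConfBiderivation DCW BCW φ) (z : ℂˣ) :
    ∃ K : ℂ, ∀ (i j : ℤ) (d l : ℂ), l ≠ 0 →
      evalPol1 z d l (φ (Lcw i) (Lcw j)) = (z ^ i : ℂˣ) * (z ^ j : ℂˣ) * K * (d + 2 * l) := by
  choose! c hc using fun (l : ℂ) (hl : l ≠ 0) => h.exists_evalPol1_eq_mul z hl
  have shift (l : ℂ) (hl : l ≠ 0) (i j : ℤ) : c l i j = (z ^ j : ℂˣ) * c l i 0 := by
    have key := h.evalPol1_leibniz z 0 l l i j 0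
    rw [add_zero, hc l hl, hc l hl, hc l hl] at key
    refine mul_left_cancel₀ (mul_ne_zero (mul_ne_zero (by norm_num : (6 : ℂ) ≠ 0) hl) hl) ?_
    linear_combination key
  have skew (l l' : ℂ) (hl : l ≠ 0) (hl' : l' ≠ 0) (hne : l ≠ l') (i j : ℤ) :
      c l i j = c l' j i := by
    have key := congrArg (evalPol1 z (-l - l') l) (h.skew (Lcw i) (Lcw j))
    rw [map_neg, evalPol1_ev1_subNeg, show -(-l - l') - l = l' by ring, hc l hl, hc l' hl'] at key
    refine mul_right_cancel₀ (sub_ne_zero.mpr hne) ?_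
    linear_combination key
  have main (l l' : ℂ) (hl : l ≠ 0) (hl' : l' ≠ 0) (hne : l ≠ l') (i j : ℤ) :
      c l i j = (z ^ i : ℂˣ) * (z ^ j : ℂˣ) * c l' 0 0 := by
    rw [shift l hl, skew l l' hl hl' hne, shift l' hl']
    ring
  refine ⟨c 1 0 0, fun i j d l hl => ?_⟩
  rw [hc l hl]
  rcases eq_or_ne l 1 with rfl | h1
  · rw [main 1 2 one_ne_zero two_ne_zero (by norm_num),
      skew 1 2 one_ne_zero two_ne_zero (by norm_num)]
  · rw [main l 1 hl one_ne_zero h1]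

theorem exists_eq_d2l_Scw (h : IsConfBiderivation DCW BCW φ) :
    ∃ a : ℤ →₀ ℂ, ∀ i j : ℤ, φ (Lcw i) (Lcw j) = d2l (Scw a i j) := by
  set x : CWR := evalVar 1 LinearMap.id (φ (Lcw 0) (Lcw 0)) with hx
  refine ⟨(2⁻¹ : ℂ) • x.mapRange (leval 0) (map_zero _), fun i j => evalPol1_ext fun z d l => ?_⟩
  obtain ⟨K, hK⟩ := h.exists_evalPol1_eq z
  have hA : evalCW z 0 x = 2 * K := by
    rw [hx, map_evalVar, LinearMap.comp_id]
    refine (hK 0 0 0 1 one_ne_zero).trans ?_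
    simp [mul_comm]
  have hA' : evalCW z 0 x = x.sum fun k p => p.eval 0 * (z ^ k : ℂˣ) := by
    simp [evalCW, loopPoly, Finsupp.sum, mul_comm]
  rw [hK i j d l l.ne_zero, evalPol1_d2l, evalCW_Scw, Finsupp.sum_smul_index (by simp),
    Finsupp.sum_mapRange_index (by simp)]
  simp only [leval_apply, mul_assoc (2⁻¹ : ℂ)]
  rw [← Finsupp.mul_sum, ← hA', hA]
  ring

end IsConfBiderivation

end Bilinear

end

/-- a map `φ` is a conformal biderivation of the loop Virasoro Lie
conformal algebra `CW` if and only if it is a skew-symmetric conformal bilinear map and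
there is a family of complex numbers `(a_k)_{k∈ℤ}` (finitely many nonzero) such that
`φ_λ(L_i, L_j) = (∂+2λ) Σ_{k∈ℤ} a_{k-i-j} L_k` for all `i, j ∈ ℤ`. -/
theorem cw_biderivation_iff (φ : CWR → CWR → Pol1 CWR) :
    IsConfBiderivation DCW BCW φ
      ↔ (IsConfBilinear DCW φ ∧ IsSkew DCW φ
          ∧ ∃ a : ℤ →₀ ℂ, ∀ i j : ℤ, φ (Lcw i) (Lcw j) = d2l (Scw a i j)) := by
  refine ⟨fun h => ⟨h.bilin, h.skew, h.exists_eq_d2l_Scw⟩, ?_⟩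
  rintro ⟨hb, hs, a, ha⟩
  exact hb.isConfBiderivation hs ha

end ConfBider
end
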